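/- arXiv:1711.07191 — 4 statements merged into one kernel-verified Lean document; each statement's English description precedes it below -/
import Mathlib

section
/- For every symmetric n×n real matrix A, the integral Z[A] = ∫_{ℝⁿ} exp(-½ xᵀAx - U(x)) dx is finite and positive, and the free energy Ω[A] = -log Z[A] is a strictly concave and infinitely differentiable function of A on the space of symmetric n×n matrices. -/
open MeasureTheory Matrix Filter Topology Real Asymptotics

attribute [local instance] Matrix.normedAddCommGroup Matrix.normedSpace

noncomputable section

/-- The partition function `Z[A] = ∫ exp(-½ xᵀAx - U(x)) dx`. -/
def Zfun (n : ℕ) (U : (Fin n → ℝ) → ℝ) (A : Matrix (Fin n) (Fin n) ℝ) : ℝ :=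
  ∫ x : Fin n → ℝ, Real.exp (-(1 / 2) * (x ⬝ᵥ A.mulVec x) - U x)

/-- The free energy `Ω[A] = -log Z[A]`. -/
def Omega (n : ℕ) (U : (Fin n → ℝ) → ℝ) (A : Matrix (Fin n) (Fin n) ℝ) : ℝ :=
  - Real.log (Zfun n U A)

/-- `U` is continuous with superquadratic growth: for every `c > 0`,
`U x - c * |x|² → +∞` as `|x| → ∞`. -/
def SuperQuadratic {n : ℕ} (U : (Fin n → ℝ) → ℝ) : Prop :=
  Continuous U ∧ ∀ c : ℝ, 0 < c →
    Tendsto (fun x : Fin n → ℝ => U x - c * ‖x‖ ^ 2) (cocompact _) atTop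

/-- A probability density on `ℝⁿ` with finite second moments and finite
differential entropy. -/
def IsGoodDensity {n : ℕ} (ρ : (Fin n → ℝ) → ℝ) : Prop :=
  Measurable ρ ∧ (∀ x, 0 ≤ ρ x) ∧ (∫ x, ρ x) = 1 ∧
  (∀ i j : Fin n, Integrable fun x => x i * x j * ρ x) ∧
  Integrable fun x => ρ x * Real.log (ρ x)

/-- Differential entropy `S(ρ) = -∫ ρ log ρ`. -/
def entropy {n : ℕ} (ρ : (Fin n → ℝ) → ℝ) : ℝ := - ∫ x, ρ x * Real.log (ρ x)

/-- Second-moment matrix `𝒢(ρ) = ∫ x xᵀ ρ(x) dx`. -/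
def momMatrix {n : ℕ} (ρ : (Fin n → ℝ) → ℝ) : Matrix (Fin n) (Fin n) ℝ :=
  Matrix.of fun i j => ∫ x, x i * x j * ρ x

/-- `𝓕[G;U] = sup { S(ρ) - ∫ U ρ : ρ ∈ 𝓜, 𝒢(ρ) = G }`. -/
def Ffun (n : ℕ) (U : (Fin n → ℝ) → ℝ) (G : Matrix (Fin n) (Fin n) ℝ) : ℝ :=
  sSup { r : ℝ | ∃ ρ : (Fin n → ℝ) → ℝ, IsGoodDensity ρ ∧
    (Integrable fun x => U x * ρ x) ∧ momMatrix ρ = G ∧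
    r = entropy ρ - ∫ x, U x * ρ x }

/-- The Luttinger-Ward functional `Φ[G;U] = 2𝓕[G;U] - Tr[log G] - n log(2πe)`.
(For positive definite `G`, `Tr[log G] = log det G`.) -/
def Phi (n : ℕ) (U : (Fin n → ℝ) → ℝ) (G : Matrix (Fin n) (Fin n) ℝ) : ℝ :=
  2 * Ffun n U G - Real.log G.det - (n : ℝ) * Real.log (2 * π * Real.exp 1)

/-- The continuous linear functional `H ↦ Tr[S * H]` on matrices. -/
def tracePairing {n : ℕ} (S : Matrix (Fin n) (Fin n) ℝ) :
    Matrix (Fin n) (Fin n) ℝ →L[ℝ] ℝ :=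
  LinearMap.toContinuousLinearMap
    { toFun := fun H => (S * H).trace
      map_add' := fun H K => by simp [Matrix.mul_add]
      map_smul' := fun c H => by simp [Matrix.mul_smul] }

theorem aux_int {n : ℕ} {U : (Fin n → ℝ) → ℝ} (hU : SuperQuadratic U) (c : ℝ) :
    Integrable fun x : Fin n → ℝ => Real.exp (c * ‖x‖ ^ 2 - U x) := by
  obtain ⟨hc, ht⟩ := hU
  have hp : 0 < |c| + n + 1 := by positivity
  obtain ⟨x0, hx0⟩ := Continuous.exists_forall_le
    (f := fun x : Fin n → ℝ => U x - (|c| + n + 1) * ‖x‖ ^ 2) (by fun_prop) (ht _ hp)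
  set M := U x0 - (|c| + n + 1) * ‖x0‖ ^ 2 with hM
  have h1 : Integrable (fun x : Fin n → ℝ => ∏ i, Real.exp (-1 * (x i) ^ 2)) :=
    Integrable.fintype_prod (f := fun (_ : Fin n) (y : ℝ) => Real.exp (-1 * y ^ 2))
      (fun i => integrable_exp_neg_mul_sq one_pos)
  refine (h1.const_mul (Real.exp (-M))).mono'
    (Continuous.aestronglyMeasurable (by fun_prop)) (Eventually.of_forall fun x => ?_)
  rw [Real.norm_of_nonneg (Real.exp_nonneg _), ← Real.exp_sum, ← Real.exp_add]
  apply Real.exp_le_exp.2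
  have h2 : ∑ i, (x i) ^ 2 ≤ n * ‖x‖ ^ 2 := by
    have : ∀ i ∈ Finset.univ, (x i) ^ 2 ≤ ‖x‖ ^ 2 := fun i _ => by
      rw [← sq_abs]
      have := norm_le_pi_norm x i
      rw [Real.norm_eq_abs] at this
      gcongr
    simpa using Finset.sum_le_sum this
  have h3 := hx0 x
  simp only [← Finset.mul_sum]
  have h4 : c * ‖x‖ ^ 2 ≤ |c| * ‖x‖ ^ 2 := by gcongr; exact le_abs_self c
  nlinarith [sq_nonneg ‖x‖]

theorem aux_deriv {n : ℕ} {U : (Fin n → ℝ) → ℝ} (hU : SuperQuadratic U)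
    {E : Type} [NormedAddCommGroup E] [NormedSpace ℝ E]
    {F : Type} [NormedAddCommGroup F] [NormedSpace ℝ F]
    (q : (Fin n → ℝ) → E →L[ℝ] ℝ) (hq : Continuous q) (K : ℝ) (hK0 : 0 ≤ K)
    (hK : ∀ x, ‖q x‖ ≤ K * ‖x‖ ^ 2)
    (g : (Fin n → ℝ) → F) (hg : Continuous g) (C c : ℝ) (hC0 : 0 ≤ C)
    (hgb : ∀ x, ‖g x‖ ≤ C * Real.exp (c * ‖x‖ ^ 2)) (A : E) :
    HasFDerivAt (fun A => ∫ x, Real.exp (q x A - U x) • g x)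
      (∫ x, Real.exp (q x A - U x) • (q x).smulRight (g x)) A := by
  have hUc := hU.1
  have hqA : ∀ B : E, Continuous fun x => q x B := fun B => hq.clm_apply continuous_const
  have hqle : ∀ x (B : E), q x B ≤ K * ‖B‖ * ‖x‖ ^ 2 := fun x B => by
    calc q x B ≤ ‖q x B‖ := le_abs_self _
      _ ≤ ‖q x‖ * ‖B‖ := (q x).le_opNorm B
      _ ≤ (K * ‖x‖ ^ 2) * ‖B‖ := by gcongr; exact hK x
      _ = _ := by ring
  refine hasFDerivAt_integral_of_dominated_of_fderiv_le
    (s := Metric.ball A 1)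
    (F' := fun A x => Real.exp (q x A - U x) • (q x).smulRight (g x))
    (bound := fun x => (K * C) * Real.exp ((K * (‖A‖ + 1) + 1 + c) * ‖x‖ ^ 2 - U x))
    (Metric.ball_mem_nhds A one_pos) ?_ ?_ ?_ ?_ ?_ ?_
  · refine Eventually.of_forall fun B => Continuous.aestronglyMeasurable ?_
    have := hqA B
    fun_prop
  · refine ((aux_int hU (K * ‖A‖ + c)).const_mul C).mono'
      (Continuous.aestronglyMeasurable (by have := hqA A; fun_prop))
      (Eventually.of_forall fun x => ?_)
    rw [norm_smul, Real.norm_of_nonneg (Real.exp_nonneg _)]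
    calc _ ≤ Real.exp (K * ‖A‖ * ‖x‖ ^ 2 - U x) * (C * Real.exp (c * ‖x‖ ^ 2)) := by
            gcongr
            · exact hqle x A
            · exact hgb x
      _ = C * (Real.exp (K * ‖A‖ * ‖x‖ ^ 2 - U x) * Real.exp (c * ‖x‖ ^ 2)) := by ring
      _ = _ := by rw [← Real.exp_add]; congr 2; ring
  · haveI : SecondCountableTopologyEither (Fin n → ℝ) (E →L[ℝ] F) :=
      secondCountableTopologyEither_of_left _ _
    refine Continuous.aestronglyMeasurable ?_
    have := hqA A
    have h2 : Continuous fun x => (q x).smulRight (g x) :=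
      (ContinuousLinearMap.smulRightL ℝ E F).continuous₂.comp (hq.prodMk hg)
    fun_prop
  · refine Eventually.of_forall fun x B hB => ?_
    have hBn : ‖B‖ ≤ ‖A‖ + 1 := by
      have h1 : ‖B - A‖ < 1 := by simpa [dist_eq_norm] using hB
      have := norm_le_norm_add_norm_sub' B A
      linarith
    rw [norm_smul, Real.norm_of_nonneg (Real.exp_nonneg _), ContinuousLinearMap.norm_smulRight_apply]
    have hx : ‖x‖ ^ 2 ≤ Real.exp (1 * ‖x‖ ^ 2) := by
      have := Real.add_one_le_exp (1 * ‖x‖ ^ 2)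
      linarith
    calc _ ≤ Real.exp (K * (‖A‖ + 1) * ‖x‖ ^ 2 - U x) *
            ((K * Real.exp (1 * ‖x‖ ^ 2)) * (C * Real.exp (c * ‖x‖ ^ 2))) := by
            gcongr
            · refine (hqle x B).trans ?_
              gcongr
            · exact (hK x).trans (by gcongr)
            · exact hgb x
      _ = (K * C) * (Real.exp (K * (‖A‖ + 1) * ‖x‖ ^ 2 - U x) * Real.exp (1 * ‖x‖ ^ 2) *
            Real.exp (c * ‖x‖ ^ 2)) := by ring
      _ = _ := by rw [← Real.exp_add, ← Real.exp_add]; congr 2; ring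
  · exact (aux_int hU _).const_mul _
  · refine Eventually.of_forall fun x B _ => ?_
    have h1 : HasFDerivAt (fun B => Real.exp (q x B - U x)) (Real.exp (q x B - U x) • q x) B :=
      ((q x).hasFDerivAt.sub_const (U x)).exp
    have h2 := h1.smul_const (g x)
    convert h2 using 1
    ext v
    simp [mul_smul]

theorem aux_contDiff {n : ℕ} {U : (Fin n → ℝ) → ℝ} (hU : SuperQuadratic U)
    {E : Type} [NormedAddCommGroup E] [NormedSpace ℝ E]
    (q : (Fin n → ℝ) → E →L[ℝ] ℝ) (hq : Continuous q) (K : ℝ) (hK0 : 0 ≤ K)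
    (hK : ∀ x, ‖q x‖ ≤ K * ‖x‖ ^ 2) (m : ℕ) :
    ∀ {F : Type} [NormedAddCommGroup F] [NormedSpace ℝ F]
    (g : (Fin n → ℝ) → F) (_ : Continuous g) (C c : ℝ) (_ : 0 ≤ C)
    (_ : ∀ x, ‖g x‖ ≤ C * Real.exp (c * ‖x‖ ^ 2)),
    ContDiff ℝ m (fun A => ∫ x, Real.exp (q x A - U x) • g x) := by
  induction m with
  | zero =>
    intro F _ _ g hg C c hC0 hgb
    refine contDiff_zero.2 (continuous_iff_continuousAt.2 fun A => ?_)
    exact (aux_deriv hU q hq K hK0 hK g hg C c hC0 hgb A).continuousAt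
  | succ m ih =>
    intro F _ _ g hg C c hC0 hgb
    push_cast
    refine contDiff_succ_iff_hasFDerivAt.2 ⟨_, ?_, fun A =>
      aux_deriv hU q hq K hK0 hK g hg C c hC0 hgb A⟩
    refine ih (fun x => (q x).smulRight (g x))
      ((ContinuousLinearMap.smulRightL ℝ E F).continuous₂.comp (hq.prodMk hg))
      (K * C) (1 + c) (by positivity) fun x => ?_
    have hx : ‖x‖ ^ 2 ≤ Real.exp (1 * ‖x‖ ^ 2) := by
      have := Real.add_one_le_exp (1 * ‖x‖ ^ 2)
      linarith
    rw [ContinuousLinearMap.norm_smulRight_apply]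
    calc _ ≤ (K * Real.exp (1 * ‖x‖ ^ 2)) * (C * Real.exp (c * ‖x‖ ^ 2)) := by
            gcongr
            · exact (hK x).trans (by gcongr)
            · exact hgb x
      _ = (K * C) * (Real.exp (1 * ‖x‖ ^ 2) * Real.exp (c * ‖x‖ ^ 2)) := by ring
      _ = _ := by rw [← Real.exp_add]; congr 2; ring

theorem qf_bound {n : ℕ} (x : Fin n → ℝ) (A : Matrix (Fin n) (Fin n) ℝ) :
    ‖-(1 / 2) * (x ⬝ᵥ A.mulVec x)‖ ≤ ((n : ℝ) * n * ‖x‖ ^ 2) * ‖A‖ := by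
  have hx : ∀ i, |x i| ≤ ‖x‖ := fun i => norm_le_pi_norm x i
  have h : |x ⬝ᵥ A.mulVec x| ≤ ((n : ℝ) * n * ‖x‖ ^ 2) * ‖A‖ := by
    simp only [dotProduct, Matrix.mulVec, Finset.mul_sum]
    calc _ ≤ ∑ i, |∑ j, x i * (A i j * x j)| := Finset.abs_sum_le_sum_abs _ _
      _ ≤ ∑ i, ∑ j, |x i * (A i j * x j)| :=
        Finset.sum_le_sum fun i _ => Finset.abs_sum_le_sum_abs _ _
      _ ≤ ∑ i : Fin n, ∑ j : Fin n, ‖x‖ * (‖A‖ * ‖x‖) := by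
        refine Finset.sum_le_sum fun i _ => Finset.sum_le_sum fun j _ => ?_
        rw [abs_mul, abs_mul]
        have hA : |A i j| ≤ ‖A‖ := Matrix.norm_entry_le_entrywise_sup_norm A
        gcongr
        · exact hx i
        · exact hx j
      _ = _ := by simp; ring
  rw [norm_mul, Real.norm_eq_abs (x ⬝ᵥ _)]
  norm_num
  nlinarith [abs_nonneg (x ⬝ᵥ A.mulVec x)]

/-- The functional `A ↦ -½ xᵀAx`. -/
def qf {n : ℕ} (x : Fin n → ℝ) (A : Matrix (Fin n) (Fin n) ℝ) : ℝ :=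
  -(1 / 2) * (x ⬝ᵥ A.mulVec x)

theorem qf_apply {n : ℕ} (x : Fin n → ℝ) (A : Matrix (Fin n) (Fin n) ℝ) :
    qf x A = -(1 / 2) * (x ⬝ᵥ A.mulVec x) := rfl

theorem qf_add {n : ℕ} (x : Fin n → ℝ) (A B : Matrix (Fin n) (Fin n) ℝ) :
    qf x (A + B) = qf x A + qf x B := by
  simp [qf_apply, Matrix.add_mulVec]; ring

theorem qf_smul {n : ℕ} (x : Fin n → ℝ) (c : ℝ) (A : Matrix (Fin n) (Fin n) ℝ) :
    qf x (c • A) = c * qf x A := by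
  simp [qf_apply, Matrix.smul_mulVec]; ring

theorem qf_cont {n : ℕ} (A : Matrix (Fin n) (Fin n) ℝ) :
    Continuous fun x : Fin n → ℝ => qf x A := by
  simp only [qf_apply, dotProduct, Matrix.mulVec]
  fun_prop

/-- Matrices with the entrywise sup norm. -/
def ME (n : ℕ) : Type := Matrix (Fin n) (Fin n) ℝ

instance ME.inst1 (n : ℕ) : NormedAddCommGroup (ME n) :=
  (Matrix.normedAddCommGroup : NormedAddCommGroup (Matrix (Fin n) (Fin n) ℝ))

instance ME.inst2 (n : ℕ) : NormedSpace ℝ (ME n) :=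
  (Matrix.normedSpace : NormedSpace ℝ (Matrix (Fin n) (Fin n) ℝ))

instance ME.inst3 (n : ℕ) : FiniteDimensional ℝ (ME n) :=
  (inferInstance : FiniteDimensional ℝ (Matrix (Fin n) (Fin n) ℝ))

/-- `qf` as a continuous linear functional. -/
def qfL {n : ℕ} (x : Fin n → ℝ) : ME n →L[ℝ] ℝ :=
  LinearMap.mkContinuous
    { toFun := fun A => qf x A
      map_add' := fun A B => qf_add x A B
      map_smul' := fun c A => qf_smul x c A }
    ((n : ℝ) * n * ‖x‖ ^ 2) (qf_bound x)

theorem qfL_cont {n : ℕ} : Continuous (qfL (n := n)) :=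
  continuous_clm_apply.2 fun A => qf_cont A

theorem qfL_norm {n : ℕ} (x : Fin n → ℝ) : ‖qfL x‖ ≤ ((n : ℝ) * n) * ‖x‖ ^ 2 :=
  LinearMap.mkContinuous_norm_le _ (by positivity) _

theorem aux_cont {n : ℕ} {U : (Fin n → ℝ) → ℝ} (hU : SuperQuadratic U)
    (A : Matrix (Fin n) (Fin n) ℝ) :
    Continuous fun x : Fin n → ℝ => qf x A - U x :=
  (qf_cont A).sub hU.1

theorem aux_intA {n : ℕ} {U : (Fin n → ℝ) → ℝ} (hU : SuperQuadratic U)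
    (A : Matrix (Fin n) (Fin n) ℝ) :
    Integrable fun x : Fin n → ℝ => Real.exp (qf x A - U x) := by
  refine (aux_int hU ((n : ℝ) * n * ‖A‖)).mono'
    (Real.continuous_exp.comp (aux_cont hU A)).aestronglyMeasurable
    (Eventually.of_forall fun x => ?_)
  rw [Real.norm_of_nonneg (Real.exp_nonneg _)]
  apply Real.exp_le_exp.2
  have := (le_abs_self _).trans (qf_bound x A)
  rw [qf_apply]
  linarith

theorem aux_pos {n : ℕ} {f : (Fin n → ℝ) → ℝ} (hf : Continuous f) (h0 : ∀ x, 0 ≤ f x)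
    (hi : Integrable f) (x : Fin n → ℝ) (hx : f x ≠ 0) : 0 < ∫ x, f x := by
  rw [integral_pos_iff_support_of_nonneg h0 hi]
  exact (hf.isOpen_support).measure_pos _ ⟨x, hx⟩

theorem aux_Zpos {n : ℕ} {U : (Fin n → ℝ) → ℝ} (hU : SuperQuadratic U)
    (A : Matrix (Fin n) (Fin n) ℝ) : 0 < Zfun n U A :=
  aux_pos (Real.continuous_exp.comp (aux_cont hU A)) (fun _ => (Real.exp_pos _).le)
    (aux_intA hU A) 0 (Real.exp_pos _).ne'

theorem aux_Zsmooth {n : ℕ} {U : (Fin n → ℝ) → ℝ} (hU : SuperQuadratic U) :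
    ContDiff ℝ (⊤ : ℕ∞) (Zfun n U) := by
  refine contDiff_infty.2 fun m => ?_
  have := aux_contDiff hU qfL qfL_cont ((n : ℝ) * n) (by positivity) qfL_norm m
    (fun _ => (1 : ℝ)) continuous_const 1 0 zero_le_one (by simp)
  simp only [smul_eq_mul, mul_one] at this
  exact this

theorem aux_quad {n : ℕ} {A B : Matrix (Fin n) (Fin n) ℝ} (hA : A.IsSymm) (hB : B.IsSymm)
    (h : ∀ x, qf x A = qf x B) : A = B := by
  have h' : ∀ x : Fin n → ℝ, x ⬝ᵥ A.mulVec x = x ⬝ᵥ B.mulVec x := fun x => by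
    have := h x
    rw [qf_apply, qf_apply] at this
    linarith
  ext i j
  have h1 := h' (Pi.single i 1)
  have h2 := h' (Pi.single j 1)
  have h3 := h' (Pi.single i 1 + Pi.single j 1)
  have hAs := hA.apply i j
  have hBs := hB.apply i j
  simp [Matrix.mulVec_add, add_dotProduct, dotProduct_add] at h1 h2 h3
  linarith

theorem aux_concave {n : ℕ} {U : (Fin n → ℝ) → ℝ} (hU : SuperQuadratic U) :
    StrictConcaveOn ℝ {A : Matrix (Fin n) (Fin n) ℝ | A.IsSymm} (Omega n U) := by
  refine ⟨fun A hA B hB a b _ _ _ => ?_, fun A hA B hB hAB a b ha hb hab => ?_⟩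
  · exact (Matrix.IsSymm.smul hA a).add (Matrix.IsSymm.smul hB b)
  have hZA := aux_Zpos hU A
  have hZB := aux_Zpos hU B
  have hZC := aux_Zpos hU (a • A + b • B)
  obtain ⟨x0, hx0⟩ : ∃ x, qf x A - U x - Real.log (Zfun n U A) ≠
      qf x B - U x - Real.log (Zfun n U B) := by
    by_contra! hcon
    apply hAB
    have h0 := hcon 0
    have e1 : qf (0 : Fin n → ℝ) A = 0 := by simp [qf_apply]
    have e2 : qf (0 : Fin n → ℝ) B = 0 := by simp [qf_apply]
    refine aux_quad hA hB fun x => ?_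
    have := hcon x
    linarith
  set s := fun x => qf x A - U x - Real.log (Zfun n U A) with hs
  set t := fun x => qf x B - U x - Real.log (Zfun n U B) with ht
  have hsc : Continuous s := (aux_cont hU A).sub continuous_const
  have htc : Continuous t := (aux_cont hU B).sub continuous_const
  have es : ∀ x, Real.exp (s x) = Real.exp (qf x A - U x) * (Zfun n U A)⁻¹ := fun x => by
    simp only [hs]
    rw [Real.exp_sub (_ - _), Real.exp_log hZA, div_eq_mul_inv]
  have et : ∀ x, Real.exp (t x) = Real.exp (qf x B - U x) * (Zfun n U B)⁻¹ := fun x => by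
    simp only [ht]
    rw [Real.exp_sub (_ - _), Real.exp_log hZB, div_eq_mul_inv]
  set L := a * Real.log (Zfun n U A) + b * Real.log (Zfun n U B) with hL
  have ec : ∀ x, Real.exp (a * s x + b * t x) =
      Real.exp (qf x (a • A + b • B) - U x) * Real.exp (-L) := fun x => by
    rw [← Real.exp_add]
    congr 1
    simp only [hs, ht, hL, qf_add, qf_smul, smul_eq_mul]
    have : b = 1 - a := by linarith
    subst this
    ring
  have is : Integrable fun x => Real.exp (s x) := by
    simp only [es]; exact (aux_intA hU A).mul_const _
  have it : Integrable fun x => Real.exp (t x) := by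
    simp only [et]; exact (aux_intA hU B).mul_const _
  have ic : Integrable fun x => Real.exp (a * s x + b * t x) := by
    simp only [ec]; exact (aux_intA hU _).mul_const _
  have vs : ∫ x, Real.exp (s x) = 1 := by
    simp only [es]; rw [integral_mul_const]; exact mul_inv_cancel₀ hZA.ne'
  have vt : ∫ x, Real.exp (t x) = 1 := by
    simp only [et]; rw [integral_mul_const]; exact mul_inv_cancel₀ hZB.ne'
  have vc : ∫ x, Real.exp (a * s x + b * t x) = Zfun n U (a • A + b • B) * Real.exp (-L) := by
    simp only [ec]; rw [integral_mul_const]; rfl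
  have key : 0 < ∫ x, ((a * Real.exp (s x) + b * Real.exp (t x)) - Real.exp (a * s x + b * t x)) := by
    refine aux_pos (by fun_prop) (fun x => ?_)
      (((is.const_mul a).add (it.const_mul b)).sub ic) x0 ?_
    · have := strictConvexOn_exp.convexOn.2 (Set.mem_univ (s x)) (Set.mem_univ (t x)) ha.le hb.le hab
      simp only [smul_eq_mul] at this
      linarith
    · have := strictConvexOn_exp.2 (Set.mem_univ (s x0)) (Set.mem_univ (t x0)) hx0 ha hb hab
      simp only [smul_eq_mul] at this
      exact (sub_pos.2 this).ne'
  have iab : Integrable fun x => a * Real.exp (s x) + b * Real.exp (t x) :=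
    (is.const_mul a).add (it.const_mul b)
  rw [integral_sub iab ic,
    integral_add (is.const_mul a) (it.const_mul b), integral_const_mul, integral_const_mul,
    vs, vt, vc] at key
  have h1 : Zfun n U (a • A + b • B) * Real.exp (-L) < 1 := by linarith
  have h2 := Real.log_lt_log (by positivity) h1
  rw [Real.log_mul hZC.ne' (Real.exp_pos _).ne', Real.log_exp, Real.log_one] at h2
  simp only [Omega, smul_eq_mul]
  linarith

/-- For every symmetric `A`, the integral `Z[A]` is finite and positive,
and `Ω[A] = -log Z[A]` is strictly concave and infinitely differentiable on the
space of symmetric matrices. -/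
theorem statement0 (n : ℕ) (hn : 1 ≤ n) (U : (Fin n → ℝ) → ℝ) (hU : SuperQuadratic U) :
    (∀ A : Matrix (Fin n) (Fin n) ℝ, A.IsSymm →
      (Integrable fun x : Fin n → ℝ =>
        Real.exp (-(1 / 2) * (x ⬝ᵥ A.mulVec x) - U x)) ∧ 0 < Zfun n U A) ∧
    StrictConcaveOn ℝ {A : Matrix (Fin n) (Fin n) ℝ | A.IsSymm} (Omega n U) ∧
    ContDiffOn ℝ (⊤ : ℕ∞) (Omega n U) {A : Matrix (Fin n) (Fin n) ℝ | A.IsSymm} := by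
  refine ⟨fun A _ => ⟨aux_intA hU A, aux_Zpos hU A⟩, aux_concave hU, ?_⟩
  exact ((aux_Zsmooth hU).log fun A => (aux_Zpos hU A).ne').neg.contDiffOn
end
end

section
/- For every symmetric n×n real matrix A, the gradient of the free energy Ω at A is the Green's function: ∂Ω/∂A_{ij}[A] = G_{ij} where G_{ij} = (1/Z[A]) ∫_{ℝⁿ} x_i x_j exp(-½ xᵀAx - U(x)) dx, and moreover the matrix G is symmetric positive definite. -/
open MeasureTheory Matrix Filter Topology Real Asymptotics

attribute [local instance] Matrix.normedAddCommGroup Matrix.normedSpace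

noncomputable section

lemma aux_quad_eq {n : ℕ} (x : Fin n → ℝ) (B : Matrix (Fin n) (Fin n) ℝ) :
    x ⬝ᵥ B.mulVec x = ∑ i, ∑ j, x i * x j * B i j := by
  simp only [dotProduct, Matrix.mulVec, Finset.mul_sum]
  exact Finset.sum_congr rfl fun i _ => Finset.sum_congr rfl fun j _ => by ring

lemma aux_coord {n : ℕ} (x : Fin n → ℝ) (i j : Fin n) : |x i * x j| ≤ ‖x‖ ^ 2 := by
  rw [abs_mul, sq]
  exact mul_le_mul (norm_le_pi_norm x i) (norm_le_pi_norm x j) (abs_nonneg _) (norm_nonneg _)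

lemma aux_quad_bound {n : ℕ} (x : Fin n → ℝ) (B : Matrix (Fin n) (Fin n) ℝ) :
    |x ⬝ᵥ B.mulVec x| ≤ (n : ℝ) ^ 2 * ‖x‖ ^ 2 * ‖B‖ := by
  rw [aux_quad_eq]
  calc |∑ i, ∑ j, x i * x j * B i j| ≤ ∑ i : Fin n, ∑ j : Fin n, ‖x‖ ^ 2 * ‖B‖ := by
        refine (Finset.abs_sum_le_sum_abs _ _).trans (Finset.sum_le_sum fun i _ => ?_)
        refine (Finset.abs_sum_le_sum_abs _ _).trans (Finset.sum_le_sum fun j _ => ?_)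
        rw [abs_mul]
        exact mul_le_mul (aux_coord x i j) (Matrix.norm_entry_le_entrywise_sup_norm B)
          (abs_nonneg _) (by positivity)
    _ = _ := by simp; ring

lemma aux_gauss (n : ℕ) : Integrable fun x : Fin n → ℝ => Real.exp (-∑ i, x i ^ 2) := by
  have h := Integrable.fintype_prod (ι := Fin n) (f := fun _ (t : ℝ) => Real.exp (-1 * t ^ 2))
    (μ := fun _ => (volume : Measure ℝ))
    (fun i => integrable_exp_neg_mul_sq one_pos)
  refine h.congr (Eventually.of_forall fun x => ?_)
  simp only [← Real.exp_sum]
  simp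

lemma aux_dom {n : ℕ} {U : (Fin n → ℝ) → ℝ} (hU : SuperQuadratic U) (c : ℝ) (hc : 0 ≤ c) :
    Integrable fun x : Fin n → ℝ => (1 + ‖x‖ ^ 2) * Real.exp (c * ‖x‖ ^ 2 - U x) := by
  obtain ⟨hcont, hgr⟩ := hU
  have hcc : Continuous fun x : Fin n → ℝ => U x - (c + 1 + n) * ‖x‖ ^ 2 := by fun_prop
  obtain ⟨x₀, hx₀⟩ := hcc.exists_forall_le (hgr (c + 1 + n) (by positivity))
  set K := U x₀ - (c + 1 + n) * ‖x₀‖ ^ 2 with hK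
  refine ((aux_gauss n).const_mul (Real.exp (-K))).mono' (by fun_prop)
    (Eventually.of_forall fun x => ?_)
  have h1 : ∑ i, x i ^ 2 ≤ n * ‖x‖ ^ 2 := by
    calc ∑ i, x i ^ 2 ≤ ∑ i : Fin n, ‖x‖ ^ 2 := Finset.sum_le_sum fun i _ => by
          have := aux_coord x i i
          rw [← sq, abs_of_nonneg (sq_nonneg _)] at this
          exact this
      _ = _ := by simp
  have h2 := hx₀ x
  have h3 : 1 + ‖x‖ ^ 2 ≤ Real.exp (‖x‖ ^ 2) := by
    linarith [Real.add_one_le_exp (‖x‖ ^ 2)]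
  rw [Real.norm_of_nonneg (by positivity), ← Real.exp_add]
  calc (1 + ‖x‖ ^ 2) * Real.exp (c * ‖x‖ ^ 2 - U x)
      ≤ Real.exp (‖x‖ ^ 2) * Real.exp (c * ‖x‖ ^ 2 - U x) := by gcongr
    _ = Real.exp (‖x‖ ^ 2 + (c * ‖x‖ ^ 2 - U x)) := (Real.exp_add _ _).symm
    _ ≤ _ := by
      apply Real.exp_le_exp.2
      nlinarith

lemma aux_wt_le {n : ℕ} (U : (Fin n → ℝ) → ℝ) (B : Matrix (Fin n) (Fin n) ℝ) (M : ℝ)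
    (hB : ‖B‖ ≤ M) (x : Fin n → ℝ) :
    Real.exp (-(1 / 2) * (x ⬝ᵥ B.mulVec x) - U x) ≤
      Real.exp (((n : ℝ) ^ 2 * M) * ‖x‖ ^ 2 - U x) := by
  apply Real.exp_le_exp.2
  have h := aux_quad_bound x B
  have h2 : (n : ℝ) ^ 2 * ‖x‖ ^ 2 * ‖B‖ ≤ (n : ℝ) ^ 2 * ‖x‖ ^ 2 * M := by gcongr
  have := neg_abs_le (x ⬝ᵥ B.mulVec x)
  have := abs_nonneg (x ⬝ᵥ B.mulVec x)
  linarith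

lemma aux_wt_cont {n : ℕ} {U : (Fin n → ℝ) → ℝ} (hU : SuperQuadratic U)
    (B : Matrix (Fin n) (Fin n) ℝ) :
    Continuous fun x : Fin n → ℝ => Real.exp (-(1 / 2) * (x ⬝ᵥ B.mulVec x) - U x) := by
  have := hU.1
  simp only [aux_quad_eq]
  fun_prop

lemma aux_wt_int {n : ℕ} {U : (Fin n → ℝ) → ℝ} (hU : SuperQuadratic U)
    (B : Matrix (Fin n) (Fin n) ℝ) :
    Integrable fun x : Fin n → ℝ => Real.exp (-(1 / 2) * (x ⬝ᵥ B.mulVec x) - U x) := by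
  refine (aux_dom hU ((n : ℝ) ^ 2 * ‖B‖) (by positivity)).mono'
    (aux_wt_cont hU B).aestronglyMeasurable (Eventually.of_forall fun x => ?_)
  rw [Real.norm_of_nonneg (by positivity)]
  refine (aux_wt_le U B _ le_rfl x).trans ?_
  exact le_mul_of_one_le_left (by positivity) (by nlinarith [sq_nonneg ‖x‖])

lemma aux_mom_int {n : ℕ} {U : (Fin n → ℝ) → ℝ} (hU : SuperQuadratic U)
    (B : Matrix (Fin n) (Fin n) ℝ) (i j : Fin n) :
    Integrable fun x : Fin n → ℝ =>
      x i * x j * Real.exp (-(1 / 2) * (x ⬝ᵥ B.mulVec x) - U x) := by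
  have hc := aux_wt_cont hU B
  refine (aux_dom hU ((n : ℝ) ^ 2 * ‖B‖) (by positivity)).mono'
    (Continuous.aestronglyMeasurable (by fun_prop)) (Eventually.of_forall fun x => ?_)
  rw [norm_mul, Real.norm_of_nonneg (Real.exp_pos _).le]
  refine mul_le_mul ?_ (aux_wt_le U B _ le_rfl x) (by positivity) (by positivity)
  exact (aux_coord x i j).trans (by linarith)

lemma aux_Z_pos {n : ℕ} {U : (Fin n → ℝ) → ℝ} (hU : SuperQuadratic U)
    (B : Matrix (Fin n) (Fin n) ℝ) : 0 < Zfun n U B :=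
  integral_pos_of_integrable_nonneg_nonzero (x := 0) (aux_wt_cont hU B) (aux_wt_int hU B)
    (fun x => (Real.exp_pos _).le) (Real.exp_pos _).ne'

/-- The entry functional. -/
def auxE {n : ℕ} (i j : Fin n) : (Fin n → Fin n → ℝ) →L[ℝ] ℝ :=
  (ContinuousLinearMap.proj (R := ℝ) (φ := fun _ : Fin n => ℝ) j).comp
    (ContinuousLinearMap.proj (R := ℝ) (φ := fun _ : Fin n => Fin n → ℝ) i)

/-- The functional `H ↦ -½ xᵀHx`. -/
def auxL {n : ℕ} (x : Fin n → ℝ) : (Fin n → Fin n → ℝ) →L[ℝ] ℝ :=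
  ∑ i, ∑ j, (-(1 / 2) * (x i * x j)) • auxE i j

lemma auxL_apply {n : ℕ} (x : Fin n → ℝ) (H : Fin n → Fin n → ℝ) :
    auxL x H = -(1 / 2) * (x ⬝ᵥ (Matrix.of H).mulVec x) := by
  rw [aux_quad_eq]
  simp only [auxL, _root_.sum_apply, _root_.smul_apply,
    Finset.mul_sum, smul_eq_mul]
  refine Finset.sum_congr rfl fun i _ => Finset.sum_congr rfl fun j _ => ?_
  change -(1 / 2) * (x i * x j) * H i j = _
  rw [Matrix.of_apply]
  ring

lemma auxL_cont {n : ℕ} : Continuous (auxL (n := n)) := by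
  unfold auxL
  fun_prop

lemma auxL_norm {n : ℕ} (x : Fin n → ℝ) : ‖auxL x‖ ≤ (n : ℝ) ^ 2 * ‖x‖ ^ 2 := by
  refine ContinuousLinearMap.opNorm_le_bound _ (by positivity) fun H => ?_
  rw [auxL_apply, norm_mul, Real.norm_eq_abs (x ⬝ᵥ (Matrix.of H).mulVec x)]
  have h : |x ⬝ᵥ (Matrix.of H).mulVec x| ≤ (n : ℝ) ^ 2 * ‖x‖ ^ 2 * ‖H‖ :=
    aux_quad_bound x (Matrix.of H)
  have := abs_nonneg (x ⬝ᵥ (Matrix.of H).mulVec x)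
  have h2 : ‖(-(1 / 2) : ℝ)‖ = 1 / 2 := by norm_num
  rw [h2]
  linarith

lemma aux_Z_deriv {n : ℕ} {U : (Fin n → ℝ) → ℝ} (hU : SuperQuadratic U)
    (A : Fin n → Fin n → ℝ) :
    Integrable (fun x : Fin n → ℝ =>
      Real.exp (-(1 / 2) * (x ⬝ᵥ (Matrix.of A).mulVec x) - U x) • auxL x) ∧
    HasFDerivAt (fun B : Fin n → Fin n → ℝ => Zfun n U (Matrix.of B))
      (∫ x : Fin n → ℝ, Real.exp (-(1 / 2) * (x ⬝ᵥ (Matrix.of A).mulVec x) - U x) • auxL x) A := by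
  have hbd : ∀ x : Fin n → ℝ, ∀ B ∈ Metric.ball A 1,
      ‖Real.exp (-(1 / 2) * (x ⬝ᵥ (Matrix.of B).mulVec x) - U x) • auxL x‖ ≤
      (n : ℝ) ^ 2 * ((1 + ‖x‖ ^ 2) *
        Real.exp (((n : ℝ) ^ 2 * (‖A‖ + 1)) * ‖x‖ ^ 2 - U x)) := by
    intro x B hB
    have hBn : ‖B‖ ≤ ‖A‖ + 1 := by
      have h1 : ‖B - A‖ < 1 := by simpa [dist_eq_norm] using hB
      have h2 := norm_le_norm_add_norm_sub' B A
      linarith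
    rw [norm_smul, Real.norm_of_nonneg (Real.exp_pos _).le]
    calc _ ≤ Real.exp (((n : ℝ) ^ 2 * (‖A‖ + 1)) * ‖x‖ ^ 2 - U x) *
            ((n : ℝ) ^ 2 * (1 + ‖x‖ ^ 2)) := by
          refine mul_le_mul (aux_wt_le U (Matrix.of B) _ hBn x) ((auxL_norm x).trans ?_)
            (norm_nonneg _) (by positivity)
          gcongr
          linarith
      _ = _ := by ring
  have hbi := (aux_dom hU ((n : ℝ) ^ 2 * (‖A‖ + 1)) (by positivity)).const_mul ((n : ℝ) ^ 2)
  have hmeas : AEStronglyMeasurable (fun x : Fin n → ℝ =>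
      Real.exp (-(1 / 2) * (x ⬝ᵥ (Matrix.of A).mulVec x) - U x) • auxL x) volume :=
    ((aux_wt_cont hU (Matrix.of A)).smul auxL_cont).aestronglyMeasurable
  refine ⟨hbi.mono' hmeas (Eventually.of_forall fun x =>
    hbd x A (Metric.mem_ball_self one_pos)), ?_⟩
  refine hasFDerivAt_integral_of_dominated_of_fderiv_le (𝕜 := ℝ)
    (F := fun B x => Real.exp (-(1 / 2) * (x ⬝ᵥ (Matrix.of B).mulVec x) - U x))
    (F' := fun B x => Real.exp (-(1 / 2) * (x ⬝ᵥ (Matrix.of B).mulVec x) - U x) • auxL x)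
    (Metric.ball_mem_nhds A one_pos)
    (Eventually.of_forall fun B => (aux_wt_cont hU (Matrix.of B)).aestronglyMeasurable)
    (aux_wt_int hU (Matrix.of A)) hmeas (Eventually.of_forall hbd) hbi
    (Eventually.of_forall fun x B _ => ?_)
  have h : HasFDerivAt (fun B => auxL x B - U x) (auxL x) B :=
    (auxL x).hasFDerivAt.sub_const _
  have h2 := h.exp
  simpa only [auxL_apply] using h2

/-- For every symmetric `A`, the gradient of `Ω` at `A` (with respect to the
pairing `⟨A,G⟩ = ½ Tr[AG]`, i.e. with Fréchet derivative `H ↦ ½ Tr[H G]`) is the Green's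
function `G_{ij} = (1/Z[A]) ∫ x_i x_j exp(-½ xᵀAx - U(x)) dx`, and `G` is symmetric
positive definite. -/
theorem statement1 (n : ℕ) (hn : 1 ≤ n) (U : (Fin n → ℝ) → ℝ) (hU : SuperQuadratic U)
    (A : Matrix (Fin n) (Fin n) ℝ) (hA : A.IsSymm)
    (G : Matrix (Fin n) (Fin n) ℝ)
    (hG : G = Matrix.of fun i j => (1 / Zfun n U A) *
      ∫ x : Fin n → ℝ, x i * x j * Real.exp (-(1 / 2) * (x ⬝ᵥ A.mulVec x) - U x)) :
    G.PosDef ∧ HasFDerivAt (Omega n U) (tracePairing ((1 / 2 : ℝ) • G)) A := by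
  have hZ := aux_Z_pos hU A
  set w : (Fin n → ℝ) → ℝ := fun x => Real.exp (-(1 / 2) * (x ⬝ᵥ A.mulVec x) - U x) with hw
  have hwc : Continuous w := aux_wt_cont hU A
  have hmi : ∀ i j, Integrable fun x : Fin n → ℝ => x i * x j * w x := aux_mom_int hU A
  have hGij : ∀ i j, G i j = (1 / Zfun n U A) * ∫ x : Fin n → ℝ, x i * x j * w x := by
    intro i j; rw [hG]; rfl
  have hsymm : ∀ i j, G i j = G j i := by
    intro i j
    rw [hGij, hGij]
    simp only [mul_comm (_ : ℝ) (_ : ℝ)]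
  have hquad : ∀ H : Fin n → Fin n → ℝ, ∑ i, ∑ j, H i j * G i j =
      (1 / Zfun n U A) * ∫ x : Fin n → ℝ, (∑ i, ∑ j, x i * x j * H i j) * w x := by
    intro H
    have h1 : ∀ x : Fin n → ℝ, (∑ i, ∑ j, x i * x j * H i j) * w x =
        ∑ i, ∑ j, H i j * (x i * x j * w x) := by
      intro x
      simp only [Finset.sum_mul]
      exact Finset.sum_congr rfl fun i _ => Finset.sum_congr rfl fun j _ => by ring
    simp only [h1]
    have hI : ∀ i j, Integrable fun x : Fin n → ℝ => H i j * (x i * x j * w x) :=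
      fun i j => (hmi i j).const_mul _
    rw [integral_finsetSum _ fun i _ => integrable_finsetSum _ fun j _ => hI i j,
      Finset.mul_sum]
    refine Finset.sum_congr rfl fun i _ => ?_
    rw [integral_finsetSum _ fun j _ => hI i j, Finset.mul_sum]
    refine Finset.sum_congr rfl fun j _ => ?_
    rw [integral_const_mul, hGij]
    ring
  constructor
  · refine Matrix.PosDef.of_dotProduct_mulVec_pos ?_ ?_
    · ext i j
      simp [hsymm j i]
    · intro v hv
      have h1 : star v ⬝ᵥ G.mulVec v = ∑ i, ∑ j, (v i * v j) * G i j := by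
        rw [star_trivial, aux_quad_eq]
      rw [h1, hquad (fun i j => v i * v j)]
      refine mul_pos (by positivity) ?_
      have h2 : ∀ x : Fin n → ℝ, (∑ i, ∑ j, x i * x j * (v i * v j))
          = (x ⬝ᵥ v) ^ 2 := by
        intro x
        rw [sq, dotProduct, Finset.sum_mul_sum]
        exact Finset.sum_congr rfl fun i _ => Finset.sum_congr rfl fun j _ => by
          ring
      have hint : Integrable fun x : Fin n → ℝ =>
          (∑ i, ∑ j, x i * x j * (v i * v j)) * w x := by
        simp only [Finset.sum_mul]
        refine integrable_finsetSum _ fun i _ => integrable_finsetSum _ fun j _ => ?_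
        refine ((hmi i j).const_mul (v i * v j)).congr (Eventually.of_forall fun x => ?_)
        ring
      refine integral_pos_of_integrable_nonneg_nonzero (x := v) (by fun_prop) hint ?_ ?_
      · intro x
        simp only [h2]
        exact mul_nonneg (sq_nonneg _) (Real.exp_pos _).le
      · simp only [h2]
        refine mul_ne_zero (pow_ne_zero _ ?_) (Real.exp_pos _).ne'
        exact fun h => hv (dotProduct_self_eq_zero.1 h)
  · obtain ⟨hi, hd⟩ := aux_Z_deriv hU A
    have h := (hd.log hZ.ne').neg
    suffices hs : HasFDerivAt (fun B : Fin n → Fin n → ℝ => -Real.log (Zfun n U (Matrix.of B)))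
        (show (Fin n → Fin n → ℝ) →L[ℝ] ℝ from tracePairing ((1 / 2 : ℝ) • G)) A from hs
    refine h.congr_fderiv ?_
    refine ContinuousLinearMap.ext fun H => ?_
    change _ = tracePairing ((1 / 2 : ℝ) • G) (Matrix.of H)
    have e1 : tracePairing ((1 / 2 : ℝ) • G) (Matrix.of H) = (1 / 2) * ∑ i, ∑ j, H i j * G i j := by
      change (((1 / 2 : ℝ) • G) * Matrix.of H).trace = _
      rw [Matrix.smul_mul, Matrix.trace_smul, smul_eq_mul]
      congr 1
      simp only [Matrix.trace, Matrix.diag, Matrix.mul_apply, Matrix.of_apply]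
      rw [Finset.sum_comm]
      refine Finset.sum_congr rfl fun i _ => Finset.sum_congr rfl fun j _ => ?_
      rw [hsymm j i, mul_comm]
    rw [e1, hquad]
    rw [_root_.neg_apply, _root_.smul_apply,
      ContinuousLinearMap.integral_apply hi]
    have e2 : ∀ x : Fin n → ℝ,
        (Real.exp (-(1 / 2) * (x ⬝ᵥ (Matrix.of A).mulVec x) - U x) • auxL x) H =
        (-(1 / 2)) * ((∑ i, ∑ j, x i * x j * H i j) * w x) := by
      intro x
      rw [_root_.smul_apply, auxL_apply, aux_quad_eq x (Matrix.of H), smul_eq_mul]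
      change w x * _ = _
      simp only [Matrix.of_apply]
      ring
    simp only [e2]
    rw [integral_const_mul, smul_eq_mul]
    change -((Zfun n U A)⁻¹ * _) = _
    ring
end
end

section
/- The functional 𝓕 is strictly concave and infinitely differentiable on the open cone of symmetric positive definite n×n matrices, and 𝓕 equals the concave Legendre conjugate of Ω, i.e., for every symmetric positive definite G, 𝓕[G] = inf over symmetric n×n matrices A of (½ Tr[AG] - Ω[A]). -/
open MeasureTheory Matrix Filter Topology Real Asymptotics

attribute [local instance] Matrix.normedAddCommGroup Matrix.normedSpace

noncomputable section

namespace EFam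

variable {X : Type} [MeasurableSpace X] {μ : Measure X}
  {E : Type} [NormedAddCommGroup E] [NormedSpace ℝ E]
  {T : X → StrongDual ℝ E} {U : X → ℝ}

structure Hyp (μ : Measure X) (T : X → StrongDual ℝ E) (U : X → ℝ) : Prop where
  hT : AEStronglyMeasurable T μ
  hU : AEStronglyMeasurable U μ
  hint : ∀ c : ℝ, Integrable (fun x => Real.exp (c * ‖T x‖ - U x)) μ

structure Good {F : Type} [NormedAddCommGroup F] (μ : Measure X) (T : X → StrongDual ℝ E)
    (U : X → ℝ) (f : X → F) : Prop where
  meas : AEStronglyMeasurable f μ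
  int : ∀ c : ℝ, Integrable (fun x => Real.exp (c * ‖T x‖ - U x) * ‖f x‖) μ

def In {F : Type} [NormedAddCommGroup F] [NormedSpace ℝ F] (μ : Measure X)
    (T : X → StrongDual ℝ E) (U : X → ℝ) (f : X → F) (A : E) : F :=
  ∫ x, Real.exp (T x A - U x) • f x ∂μ

section
variable {F : Type} [NormedAddCommGroup F] [NormedSpace ℝ F]

theorem exp_bd (x : X) {A : E} {R : ℝ} (hA : ‖A‖ ≤ R) :
    Real.exp (T x A - U x) ≤ Real.exp (R * ‖T x‖ - U x) := by
  apply Real.exp_le_exp.2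
  have h1 : T x A ≤ ‖T x‖ * ‖A‖ := (le_abs_self _).trans ((T x).le_opNorm A)
  have h2 : ‖T x‖ * ‖A‖ ≤ ‖T x‖ * R := by gcongr
  linarith [mul_comm R ‖T x‖]

theorem Hyp.meas_exp (h : Hyp μ T U) (A : E) :
    AEStronglyMeasurable (fun x => Real.exp (T x A - U x)) μ := by
  have h1 : AEStronglyMeasurable (fun x => T x A) μ :=
    (ContinuousLinearMap.apply ℝ ℝ A).continuous.comp_aestronglyMeasurable h.hT
  exact Real.continuous_exp.comp_aestronglyMeasurable (h1.sub h.hU)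

theorem Hyp.integrable (h : Hyp μ T U) {f : X → F} (hf : Good μ T U f) (A : E) :
    Integrable (fun x => Real.exp (T x A - U x) • f x) μ := by
  refine (hf.int ‖A‖).mono ((h.meas_exp A).smul hf.meas) (ae_of_all _ fun x => ?_)
  rw [norm_smul, Real.norm_eq_abs, Real.norm_eq_abs, abs_of_pos (Real.exp_pos _), abs_of_nonneg (by positivity)]
  exact mul_le_mul_of_nonneg_right (exp_bd x le_rfl) (norm_nonneg _)

theorem Hyp.good_smulRight (h : Hyp μ T U) {f : X → F} (hf : Good μ T U f) :
    Good μ T U (fun x => (T x).smulRight (f x)) := by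
  have hm : AEStronglyMeasurable (fun x => (T x).smulRight (f x)) μ := by
    exact (ContinuousLinearMap.smulRightL ℝ E F).continuous₂.comp_aestronglyMeasurable
      (h.hT.prodMk hf.meas)
  refine ⟨hm, fun c => ?_⟩
  have hme : AEStronglyMeasurable (fun x => Real.exp (c * ‖T x‖ - U x)) μ :=
    Real.continuous_exp.comp_aestronglyMeasurable ((h.hT.norm.const_mul c).sub h.hU)
  refine (hf.int (c + 1)).mono (hme.mul hm.norm) (ae_of_all _ fun x => ?_)
  rw [Real.norm_eq_abs, Real.norm_eq_abs, abs_of_nonneg (by positivity), abs_of_nonneg (by positivity)]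
  rw [ContinuousLinearMap.norm_smulRight_apply, ← mul_assoc]
  gcongr
  have : (c + 1) * ‖T x‖ - U x = (c * ‖T x‖ - U x) + ‖T x‖ := by ring
  rw [this, Real.exp_add]
  gcongr
  linarith [Real.add_one_le_exp ‖T x‖]

theorem Hyp.hasFDerivAt (h : Hyp μ T U) {f : X → F} (hf : Good μ T U f) (A : E) :
    HasFDerivAt (In μ T U f) (In μ T U (fun x => (T x).smulRight (f x)) A) A := by
  have hg := h.good_smulRight hf
  refine hasFDerivAt_integral_of_dominated_of_fderiv_le
    (F := fun A x => Real.exp (T x A - U x) • f x)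
    (F' := fun A x => Real.exp (T x A - U x) • (T x).smulRight (f x))
    (bound := fun x => Real.exp ((‖A‖ + 1) * ‖T x‖ - U x) * ‖(T x).smulRight (f x)‖)
    (s := Metric.ball A 1)
    (Metric.ball_mem_nhds A one_pos) (Eventually.of_forall fun B => (h.meas_exp B).smul hf.meas)
    (h.integrable hf A) ((h.meas_exp A).smul hg.meas) (ae_of_all _ fun x B hB => ?_)
    (hg.int _) (ae_of_all _ fun x B hB => ?_)
  · rw [norm_smul, Real.norm_eq_abs, abs_of_pos (Real.exp_pos _)]
    refine mul_le_mul_of_nonneg_right ?_ (norm_nonneg _)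
    apply exp_bd
    have h1 : ‖B - A‖ < 1 := by simpa [dist_eq_norm] using hB
    have h2 : ‖B‖ ≤ ‖A‖ + ‖B - A‖ := by
      have := norm_add_le A (B - A)
      simpa using this
    linarith
  · have h1 : HasFDerivAt (fun B => Real.exp (T x B - U x)) (Real.exp (T x B - U x) • T x) B :=
      (((T x).hasFDerivAt).sub_const (U x)).exp
    have h2 := h1.smul_const (f x)
    convert h2 using 1
    ext v
    simp [mul_smul]

end

theorem Hyp.contDiff (h : Hyp μ T U) (k : ℕ) : ∀ {F : Type} [NormedAddCommGroup F]
    [NormedSpace ℝ F] {f : X → F} (_ : Good μ T U f), ContDiff ℝ k (In μ T U f) := by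
  induction k with
  | zero =>
    intro F _ _ f hf
    exact contDiff_zero.2 (continuous_iff_continuousAt.2 fun A => (h.hasFDerivAt hf A).continuousAt)
  | succ k ih =>
    intro F _ _ f hf
    push_cast
    rw [contDiff_succ_iff_hasFDerivAt]
    exact ⟨_, ih (h.good_smulRight hf), fun A => h.hasFDerivAt hf A⟩

theorem Hyp.good_one (h : Hyp μ T U) : Good μ T U (fun _ => (1 : ℝ)) :=
  ⟨aestronglyMeasurable_const, fun c => by simpa using h.hint c⟩

theorem smulRight_one' (L : StrongDual ℝ E) : L.smulRight (1 : ℝ) = L := by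
  ext v; simp

theorem Hyp.good_T (h : Hyp μ T U) : Good μ T U T := by
  have := h.good_smulRight h.good_one
  simpa only [smulRight_one'] using this

def Z (μ : Measure X) (T : X → StrongDual ℝ E) (U : X → ℝ) (A : E) : ℝ :=
  In μ T U (fun _ => (1 : ℝ)) A

def N (μ : Measure X) (T : X → StrongDual ℝ E) (U : X → ℝ) (A : E) : StrongDual ℝ E :=
  In μ T U T A

def M (μ : Measure X) (T : X → StrongDual ℝ E) (U : X → ℝ) (A : E) : StrongDual ℝ E :=
  (Z μ T U A)⁻¹ • N μ T U A

def Dom (μ : Measure X) (T : X → StrongDual ℝ E) : Set (StrongDual ℝ E) :=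
  {g | ∀ A : E, A ≠ 0 → 0 < μ {x | g A < T x A}}

theorem Z_eq (A : E) : Z μ T U A = ∫ x, Real.exp (T x A - U x) ∂μ := by simp [Z, In]

theorem Hyp.int1 (h : Hyp μ T U) (A : E) : Integrable (fun x => Real.exp (T x A - U x)) μ := by
  simpa using h.integrable h.good_one A

theorem Hyp.intT (h : Hyp μ T U) (A B : E) :
    Integrable (fun x => Real.exp (T x A - U x) * T x B) μ := by
  simpa using (h.integrable h.good_T A).apply_continuousLinearMap B

theorem Hyp.intTT (h : Hyp μ T U) (A B C : E) :
    Integrable (fun x => Real.exp (T x A - U x) * (T x B * T x C)) μ := by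
  simpa using ((h.integrable (h.good_smulRight h.good_T) A).apply_continuousLinearMap
    B).apply_continuousLinearMap C

theorem Hyp.N_apply (h : Hyp μ T U) (A B : E) :
    N μ T U A B = ∫ x, Real.exp (T x A - U x) * T x B ∂μ := by
  rw [N, In, ContinuousLinearMap.integral_apply (h.integrable h.good_T A)]
  simp

theorem Hyp.Z_pos [NeZero μ] (h : Hyp μ T U) (A : E) : 0 < Z μ T U A := by
  rw [Z_eq]
  exact integral_exp_pos (h.int1 A)

theorem Hyp.hasFDerivAt_Z (h : Hyp μ T U) (A : E) :
    HasFDerivAt (Z μ T U) (N μ T U A) A := by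
  have := h.hasFDerivAt h.good_one A
  simp only [smulRight_one'] at this
  exact this

theorem contDiff_top {F : Type} [NormedAddCommGroup F]
    [NormedSpace ℝ F] {f : X → F} (h : Hyp μ T U) (hf : Good μ T U f) :
    ContDiff ℝ (⊤ : ℕ∞) (In μ T U f) := contDiff_infty.2 fun k => h.contDiff k hf

theorem Hyp.contDiff_Z (h : Hyp μ T U) : ContDiff ℝ (⊤ : ℕ∞) (Z μ T U) :=
  contDiff_top h h.good_one

theorem Hyp.contDiff_M [NeZero μ] (h : Hyp μ T U) : ContDiff ℝ (⊤ : ℕ∞) (M μ T U) :=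
  (h.contDiff_Z.inv fun A => (h.Z_pos A).ne').smul (contDiff_top h h.good_T)

/-- critical points are strict minimizers -/
theorem Hyp.strict_min [NeZero μ] (h : Hyp μ T U) {g : StrongDual ℝ E} (hg : g ∈ Dom μ T) {a b : E}
    (hab : b ≠ a) (ha : M μ T U a = g) :
    Real.log (Z μ T U a) - g a < Real.log (Z μ T U b) - g b := by
  have hNZ : N μ T U a = Z μ T U a • g := by
    rw [← ha, M, smul_smul, mul_inv_cancel₀ (h.Z_pos a).ne', one_smul]
  suffices hs : Z μ T U a * Real.exp (- g a) < Z μ T U b * Real.exp (- g b) by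
    have := Real.log_lt_log (mul_pos (h.Z_pos a) (Real.exp_pos _)) hs
    rw [Real.log_mul (h.Z_pos a).ne' (Real.exp_pos _).ne',
      Real.log_mul (h.Z_pos b).ne' (Real.exp_pos _).ne', Real.log_exp, Real.log_exp] at this
    linarith
  have key : 0 < ∫ x, (Real.exp (T x b - U x) * Real.exp (- g b)
      - (Real.exp (T x a - U x) * Real.exp (- g a)
        + Real.exp (-g a) * (Real.exp (T x a - U x) * T x (b - a)
          - Real.exp (T x a - U x) * g (b - a)))) ∂μ := by
    have pw : ∀ x, Real.exp (T x b - U x) * Real.exp (- g b)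
      - (Real.exp (T x a - U x) * Real.exp (- g a)
        + Real.exp (-g a) * (Real.exp (T x a - U x) * T x (b - a)
          - Real.exp (T x a - U x) * g (b - a)))
        = Real.exp (T x a - U x) * Real.exp (- g a) * (Real.exp (T x (b-a) - g (b-a)) -
          ((T x (b-a) - g (b-a)) + 1)) := by
      intro x
      have e1 : Real.exp (T x b - U x) * Real.exp (- g b) = Real.exp (T x a - U x) * Real.exp (- g a) *
        Real.exp (T x (b-a) - g (b-a)) := by
        rw [← Real.exp_add, ← Real.exp_add, ← Real.exp_add]
        congr 1
        simp only [map_sub]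
        ring
      rw [e1]; ring
    have hint : Integrable (fun x => (Real.exp (T x b - U x) * Real.exp (- g b)
      - (Real.exp (T x a - U x) * Real.exp (- g a)
        + Real.exp (-g a) * (Real.exp (T x a - U x) * T x (b - a)
          - Real.exp (T x a - U x) * g (b - a))))) μ :=
      ((h.int1 b).mul_const _).sub (((h.int1 a).mul_const _).add
        (((h.intT a _).sub ((h.int1 a).mul_const _)).const_mul _))
    rw [integral_pos_iff_support_of_nonneg _ hint]
    · refine lt_of_lt_of_le (hg (b - a) (sub_ne_zero.2 hab)) (measure_mono fun x hx => ?_)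
      rw [Function.mem_support, pw]
      have hx' : g (b - a) < T x (b - a) := hx
      have := Real.add_one_lt_exp (x := T x (b-a) - g (b-a)) (by linarith)
      refine (mul_pos (by positivity) (by linarith)).ne'
    · intro x
      simp only [Pi.zero_apply]
      rw [pw]
      have := Real.add_one_le_exp (T x (b-a) - g (b-a))
      exact mul_nonneg (by positivity) (by linarith)
  have i1 : Integrable (fun x => Real.exp (-g a) * (Real.exp (T x a - U x) * T x (b - a)
          - Real.exp (T x a - U x) * g (b - a))) μ :=
    ((h.intT a _).sub ((h.int1 a).mul_const _)).const_mul _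
  have i2 : Integrable (fun x => Real.exp (T x a - U x) * Real.exp (- g a)
        + Real.exp (-g a) * (Real.exp (T x a - U x) * T x (b - a)
          - Real.exp (T x a - U x) * g (b - a))) μ := ((h.int1 a).mul_const _).add i1
  rw [integral_sub ((h.int1 b).mul_const _) i2, integral_add ((h.int1 a).mul_const _) i1,
    integral_const_mul, integral_sub (h.intT a _) ((h.int1 a).mul_const _), integral_mul_const,
    integral_mul_const, integral_mul_const, ← h.N_apply, ← Z_eq, ← Z_eq, hNZ] at key
  simp only [_root_.smul_apply, smul_eq_mul, sub_self, mul_zero, add_zero] at key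
  linarith

theorem Hyp.inj [NeZero μ] (h : Hyp μ T U) {g : StrongDual ℝ E} (hg : g ∈ Dom μ T) {a b : E}
    (ha : M μ T U a = g) (hb : M μ T U b = g) : a = b := by
  by_contra hab
  exact lt_asymm (h.strict_min hg hab hb) (h.strict_min hg (Ne.symm hab) ha)

variable [FiniteDimensional ℝ E]

theorem Hyp.exists_crit [NeZero μ] (h : Hyp μ T U) {g : StrongDual ℝ E} (hg : g ∈ Dom μ T) :
    ∃ a, M μ T U a = g := by
  have : ProperSpace E := FiniteDimensional.proper_real E
  have hmU : AEStronglyMeasurable (fun x => Real.exp (- U x)) μ :=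
    Real.continuous_exp.comp_aestronglyMeasurable h.hU.neg
  have hmT : ∀ A : E, AEStronglyMeasurable (fun x => T x A) μ := fun A =>
    (ContinuousLinearMap.apply ℝ ℝ A).continuous.comp_aestronglyMeasurable h.hT
  have hmF : ∀ A : E, AEStronglyMeasurable
      (fun x => Real.exp (- U x) * max (T x A - g A) 0) μ := fun A =>
    hmU.mul (((hmT A).sub aestronglyMeasurable_const).sup aestronglyMeasurable_const)
  have hbd : Integrable (fun x => Real.exp (- U x) * (‖T x‖ + ‖g‖)) μ := by
    have h1 := (h.good_T.int 0)
    have h2 := (h.good_one.int 0).mul_const ‖g‖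
    refine (h1.add h2).congr (ae_of_all _ fun x => ?_)
    simp [mul_add]
  have hle : ∀ (A : E) x, max (T x A - g A) 0 ≤ (‖T x‖ + ‖g‖) * ‖A‖ := by
    intro A x
    apply max_le _ (by positivity)
    have h1 : T x A ≤ ‖T x‖ * ‖A‖ := (le_abs_self _).trans ((T x).le_opNorm A)
    have h2 : - g A ≤ ‖g‖ * ‖A‖ := (neg_le_abs _).trans (g.le_opNorm A)
    linarith
  have hnn : ∀ (A : E) x, 0 ≤ Real.exp (- U x) * max (T x A - g A) 0 := fun A x => by positivity
  have hint : ∀ A : E, Integrable (fun x => Real.exp (- U x) * max (T x A - g A) 0) μ := by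
    intro A
    refine (hbd.mul_const ‖A‖).mono' (hmF A) (ae_of_all _ fun x => ?_)
    rw [Real.norm_eq_abs, abs_of_nonneg (hnn A x), mul_assoc]
    gcongr
    exact hle A x
  obtain ⟨m, hm, hmle⟩ : ∃ m, 0 < m ∧ ∀ A ∈ Metric.sphere (0 : E) 1,
      m ≤ ∫ x, Real.exp (- U x) * max (T x A - g A) 0 ∂μ := by
    refine (isCompact_sphere (0 : E) 1).exists_forall_le' ?_ ?_
    · refine continuousOn_of_dominated (bound := fun x => Real.exp (- U x) * (‖T x‖ + ‖g‖))
        (fun A _ => hmF A) (fun A hA => ae_of_all _ fun x => ?_) hbd (ae_of_all _ fun x => ?_)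
      · rw [Real.norm_eq_abs, abs_of_nonneg (hnn A x)]
        gcongr
        have := hle A x
        rwa [mem_sphere_zero_iff_norm.1 hA, mul_one] at this
      · exact Continuous.continuousOn (by fun_prop)
    · intro A hA
      rw [integral_pos_iff_support_of_nonneg (hnn A) (hint A)]
      have hA0 : A ≠ 0 := by
        rintro rfl
        simp at hA
      refine lt_of_lt_of_le (hg A hA0) (measure_mono fun x hx => ?_)
      have hx' : g A < T x A := hx
      rw [Function.mem_support]
      refine (mul_pos (Real.exp_pos _) (lt_max_of_lt_left (by linarith))).ne'
  have hJ : ∀ A : E, m * ‖A‖ ≤ Z μ T U A * Real.exp (- g A) := by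
    intro A
    rcases eq_or_ne A 0 with rfl | hA
    · simpa using (h.Z_pos (0:E)).le
    have hA' : 0 < ‖A‖ := norm_pos_iff.2 hA
    have h1 := hmle (‖A‖⁻¹ • A) (by simp [norm_smul, hA'.ne'])
    have h2 : ∀ x, Real.exp (- U x) * max (T x (‖A‖⁻¹ • A) - g (‖A‖⁻¹ • A)) 0 =
        ‖A‖⁻¹ * (Real.exp (- U x) * max (T x A - g A) 0) := by
      intro x
      simp only [map_smul, smul_eq_mul]
      rw [← mul_sub]
      have : max (‖A‖⁻¹ * (T x A - g A)) 0 = ‖A‖⁻¹ * max (T x A - g A) 0 := by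
        rw [mul_max_of_nonneg _ _ (by positivity), mul_zero]
      rw [this]; ring
    simp_rw [h2] at h1
    rw [integral_const_mul, le_inv_mul_iff₀ hA'] at h1
    rw [mul_comm]
    refine h1.trans ?_
    rw [Z_eq, ← integral_mul_const]
    refine integral_mono (hint A) ((h.int1 A).mul_const _) fun x => ?_
    have e : Real.exp (T x A - U x) * Real.exp (- g A) =
        Real.exp (- U x) * Real.exp (T x A - g A) := by
      rw [← Real.exp_add, ← Real.exp_add]; congr 1; ring
    simp only [e]
    gcongr
    exact max_le (by linarith [Real.add_one_le_exp (T x A - g A)]) (Real.exp_pos _).le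
  have hcont : Continuous (fun A => Z μ T U A * Real.exp (- g A)) :=
    h.contDiff_Z.continuous.mul (by fun_prop)
  obtain ⟨a, ha⟩ := hcont.exists_forall_le
    (tendsto_atTop_mono hJ ((tendsto_norm_cocompact_atTop (E := E)).const_mul_atTop hm))
  refine ⟨a, ?_⟩
  have hd : HasFDerivAt (fun A => Z μ T U A * Real.exp (- g A))
      (Z μ T U a • (Real.exp (- g a) • (-g)) + Real.exp (- g a) • N μ T U a) a :=
    (h.hasFDerivAt_Z a).mul (g.hasFDerivAt.neg.exp)
  have h0 := (show IsLocalMin _ a from Eventually.of_forall ha).hasFDerivAt_eq_zero hd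
  have h1 : Real.exp (- g a) • (N μ T U a - Z μ T U a • g) = 0 := by
    rw [← h0, smul_sub, smul_neg, smul_neg, smul_comm]
    abel
  rw [smul_eq_zero_iff_right (Real.exp_pos _).ne', sub_eq_zero] at h1
  rw [M, h1, smul_smul, inv_mul_cancel₀ (h.Z_pos a).ne', one_smul]

theorem Hyp.exists_equiv [NeZero μ] (h : Hyp μ T U) {a : E} (hg : M μ T U a ∈ Dom μ T) :
    ∃ L : E ≃L[ℝ] StrongDual ℝ E, HasFDerivAt (M μ T U) (L : E →L[ℝ] StrongDual ℝ E) a := by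
  set g := M μ T U a with hgdef
  have hNZ : N μ T U a = Z μ T U a • g := by
    rw [hgdef, M, smul_smul, mul_inv_cancel₀ (h.Z_pos a).ne', one_smul]
  have hd : DifferentiableAt ℝ (M μ T U) a :=
    h.contDiff_M.contDiffAt.differentiableAt (by simp)
  -- N = Z • M, differentiate
  have hN := h.hasFDerivAt h.good_T a
  have hZM : HasFDerivAt (fun A => Z μ T U A • M μ T U A)
    (Z μ T U a • fderiv ℝ (M μ T U) a + (N μ T U a).smulRight (M μ T U a)) a :=
    (h.hasFDerivAt_Z a).smul hd.hasFDerivAt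
  have heq : (fun A => Z μ T U A • M μ T U A) = In μ T U T := by
    ext1 A
    rw [M, smul_smul, mul_inv_cancel₀ (h.Z_pos A).ne', one_smul, N]
  rw [heq] at hZM
  have hu := hZM.unique hN
  have hker : ∀ H, fderiv ℝ (M μ T U) a H = 0 → H = 0 := by
    intro H hH
    by_contra hne
    have h1 := congrArg (fun L => L H H) hu
    simp only [_root_.add_apply, _root_.smul_apply, hH,
      ContinuousLinearMap.smulRight_apply, hNZ, smul_zero, zero_add, ← hgdef, smul_eq_mul] at h1
    have h2 : (In μ T U (fun x => (T x).smulRight (T x)) a) H H =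
        ∫ x, Real.exp (T x a - U x) * (T x H * T x H) ∂μ := by
      have hi := h.integrable (h.good_smulRight h.good_T) a
      rw [In, ContinuousLinearMap.integral_apply hi,
        ContinuousLinearMap.integral_apply (hi.apply_continuousLinearMap H)]
      simp
    rw [h2] at h1
    have hint : Integrable (fun x => Real.exp (T x a - U x) * (T x H * T x H)
        - 2 * g H * (Real.exp (T x a - U x) * T x H) + g H ^ 2 * Real.exp (T x a - U x)) μ :=
      ((h.intTT a H H).sub ((h.intT a H).const_mul _)).add ((h.int1 a).const_mul _)
    have pw : ∀ x, Real.exp (T x a - U x) * (T x H * T x H)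
        - 2 * g H * (Real.exp (T x a - U x) * T x H) + g H ^ 2 * Real.exp (T x a - U x) =
        Real.exp (T x a - U x) * (T x H - g H) ^ 2 := fun x => by ring
    have key : 0 < ∫ x, Real.exp (T x a - U x) * (T x H * T x H)
        - 2 * g H * (Real.exp (T x a - U x) * T x H) + g H ^ 2 * Real.exp (T x a - U x) ∂μ := by
      rw [integral_pos_iff_support_of_nonneg _ hint]
      · refine lt_of_lt_of_le (hg H hne) (measure_mono fun x hx => ?_)
        have hx' : g H < T x H := hx
        rw [Function.mem_support, pw]
        have : 0 < T x H - g H := by linarith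
        positivity
      · intro x
        simp only [Pi.zero_apply]
        rw [pw]; positivity
    have i1 : Integrable (fun x => Real.exp (T x a - U x) * (T x H * T x H)
        - 2 * g H * (Real.exp (T x a - U x) * T x H)) μ :=
      (h.intTT a H H).sub ((h.intT a H).const_mul _)
    rw [integral_add i1 ((h.int1 a).const_mul _),
      integral_sub (h.intTT a H H) ((h.intT a H).const_mul _), integral_const_mul,
      integral_const_mul, ← h.N_apply, ← Z_eq, ← h1, hNZ] at key
    simp only [_root_.smul_apply, smul_eq_mul] at key
    nlinarith
  have hinj : Function.Injective (fderiv ℝ (M μ T U) a : E →ₗ[ℝ] StrongDual ℝ E) :=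
    (injective_iff_map_eq_zero _).2 hker
  have hfr : Module.finrank ℝ E = Module.finrank ℝ (StrongDual ℝ E) := by
    rw [← Subspace.dual_finrank_eq (K := ℝ) (V := E)]
    exact (LinearMap.toContinuousLinearMap (𝕜 := ℝ) (E := E) (F' := ℝ)).finrank_eq
  have : CompleteSpace E := FiniteDimensional.complete ℝ E
  have hsurj := (LinearMap.injective_iff_surjective_of_finrank_eq_finrank hfr).1 hinj
  refine ⟨ContinuousLinearEquiv.ofBijective (fderiv ℝ (M μ T U) a)
    (LinearMap.ker_eq_bot.2 hinj) (LinearMap.range_eq_top.2 hsurj), ?_⟩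
  rw [ContinuousLinearEquiv.coe_ofBijective]
  exact hd.hasFDerivAt

/-- Any function which is equal to the value at the critical point is smooth. -/
theorem Hyp.smooth [NeZero μ] (h : Hyp μ T U) (f : StrongDual ℝ E → ℝ)
    (hf : ∀ g ∈ Dom μ T, ∀ a, M μ T U a = g → f g = Real.log (Z μ T U a) - g a) :
    ContDiffOn ℝ (⊤ : ℕ∞) f (Dom μ T) := by
  intro g hg
  have : CompleteSpace E := FiniteDimensional.complete ℝ E
  obtain ⟨a, ha⟩ := h.exists_crit hg
  subst ha
  obtain ⟨L, hL⟩ := h.exists_equiv hg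
  have hM : ContDiffAt ℝ (⊤ : ℕ∞) (M μ T U) a := h.contDiff_M.contDiffAt
  have htop : (((⊤ : ℕ∞) : WithTop ℕ∞)) ≠ 0 := by simp
  have hinv := hM.to_localInverse hL htop
  have hri : ∀ᶠ y in 𝓝 (M μ T U a), M μ T U (hM.localInverse hL htop y) = y :=
    (hM.hasStrictFDerivAt' hL htop).eventually_right_inverse
  have hsm : ContDiffAt ℝ (⊤ : ℕ∞) (fun y => Real.log (Z μ T U (hM.localInverse hL htop y))
      - y (hM.localInverse hL htop y)) (M μ T U a) := by
    refine ContDiffAt.sub (ContDiffAt.log ?_ (h.Z_pos _).ne') ?_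
    · exact h.contDiff_Z.contDiffAt.comp _ hinv
    · exact contDiffAt_id.clm_apply hinv
  refine hsm.contDiffWithinAt.congr_of_eventuallyEq ?_ (hf _ hg _ hri.self_of_nhds)
  filter_upwards [mem_nhdsWithin_of_mem_nhds hri, self_mem_nhdsWithin] with y hy hyD
  exact hf y hyD _ hy

end EFam

section Concrete

variable {n : ℕ}

def symS (n : ℕ) : Submodule ℝ (Matrix (Fin n) (Fin n) ℝ) where
  carrier := {A | A.IsSymm}
  add_mem' := fun ha hb => Matrix.IsSymm.add ha hb
  zero_mem' := Matrix.isSymm_zero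
  smul_mem' := fun c _ ha => Matrix.IsSymm.smul ha c

def SymT (n : ℕ) : Type := symS n

instance : NormedAddCommGroup (SymT n) := inferInstanceAs (NormedAddCommGroup (symS n))
instance : NormedSpace ℝ (SymT n) := inferInstanceAs (NormedSpace ℝ (symS n))
instance : FiniteDimensional ℝ (SymT n) := inferInstanceAs (FiniteDimensional ℝ (symS n))

def SymT.val (A : SymT n) : Matrix (Fin n) (Fin n) ℝ := Subtype.val A
theorem SymT.prop (A : SymT n) : A.val.IsSymm := Subtype.prop A
def SymT.mk (A : Matrix (Fin n) (Fin n) ℝ) (h : A.IsSymm) : SymT n := Subtype.mk A h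
theorem SymT.mk_val (A : Matrix (Fin n) (Fin n) ℝ) (h : A.IsSymm) : (SymT.mk A h).val = A := rfl
theorem SymT.ext' {A B : SymT n} (h : A.val = B.val) : A = B := Subtype.ext h
theorem SymT.val_add (A B : SymT n) : (A + B).val = A.val + B.val := rfl
theorem SymT.val_zero : (0 : SymT n).val = 0 := rfl
theorem SymT.val_smul (c : ℝ) (A : SymT n) : (c • A).val = c • A.val := rfl
theorem SymT.norm_entry (A : SymT n) (i j : Fin n) : |A.val i j| ≤ ‖A‖ :=
  Matrix.norm_entry_le_entrywise_sup_norm (A.val)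

def Tq (x : Fin n → ℝ) : StrongDual ℝ (SymT n) :=
  LinearMap.toContinuousLinearMap
    { toFun := fun A => -(1 / 2) * (x ⬝ᵥ A.val.mulVec x)
      map_add' := fun A B => by
        simp only [SymT.val_add, Matrix.add_mulVec, dotProduct_add]; ring
      map_smul' := fun c A => by
        simp only [SymT.val_smul, Matrix.smul_mulVec, dotProduct_smul, smul_eq_mul,
          RingHom.id_apply]; ring }

theorem Tq_apply (x : Fin n → ℝ) (A : SymT n) :
    Tq x A = -(1 / 2) * (x ⬝ᵥ A.val.mulVec x) := rfl

def gq0 (G : Matrix (Fin n) (Fin n) ℝ) : StrongDual ℝ (SymT n) :=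
  LinearMap.toContinuousLinearMap
        { toFun := fun A => -(1 / 2) * (A.val * G).trace
          map_add' := fun A B => by
            simp only [SymT.val_add, Matrix.add_mul, Matrix.trace_add]; ring
          map_smul' := fun c A => by
            simp only [SymT.val_smul, Matrix.smul_mul, Matrix.trace_smul, smul_eq_mul,
              RingHom.id_apply]; ring }

def gq (n : ℕ) : Matrix (Fin n) (Fin n) ℝ →L[ℝ] StrongDual ℝ (SymT n) :=
  LinearMap.toContinuousLinearMap
    { toFun := gq0
      map_add' := fun G H => by
        ext A
        change -(1 / 2) * (A.val * (G + H)).trace =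
          -(1 / 2) * (A.val * G).trace +
          -(1 / 2) * (A.val * H).trace
        rw [Matrix.mul_add, Matrix.trace_add]; ring
      map_smul' := fun c G => by
        ext A
        change -(1 / 2) * (A.val * (c • G)).trace =
          c * (-(1 / 2) * (A.val * G).trace)
        rw [Matrix.mul_smul, Matrix.trace_smul, smul_eq_mul]; ring }

theorem gq_apply (G : Matrix (Fin n) (Fin n) ℝ) (A : SymT n) :
    gq n G A = -(1 / 2) * (A.val * G).trace := rfl

theorem gq_inj {G H : Matrix (Fin n) (Fin n) ℝ} (hG : G.IsSymm) (hH : H.IsSymm)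
    (h : gq n G = gq n H) : G = H := by
  have hD : (G - H).IsSymm := hG.sub hH
  have h1 : gq n (G - H) = 0 := by rw [map_sub, h, sub_self]
  have h2 := congrArg (fun L => L (SymT.mk (G - H) hD)) h1
  simp only [gq_apply, _root_.zero_apply, SymT.mk_val] at h2
  have h3 : ((G - H)ᴴ * (G - H)).trace = 0 := by
    rw [Matrix.conjTranspose_eq_transpose_of_trivial, hD.eq]
    linarith
  exact sub_eq_zero.1 (Matrix.trace_conjTranspose_mul_self_eq_zero_iff.1 h3)

theorem trace_pos_aux {A G : Matrix (Fin n) (Fin n) ℝ} (hA : A.PosSemidef) (hA0 : A ≠ 0)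
    (hG : G.PosDef) : 0 < (A * G).trace := by
  obtain ⟨m, v, rfl⟩ := Matrix.posSemidef_iff_eq_sum_vecMulVec.mp hA
  have e : ∀ i, (Matrix.vecMulVec (v i) (star (v i)) * G).trace = star (v i) ⬝ᵥ G.mulVec (v i) := by
    intro i
    rw [Matrix.trace_mul_comm, Matrix.mul_vecMulVec, Matrix.trace_vecMulVec, dotProduct_comm]
  rw [Matrix.sum_mul, Matrix.trace_sum]
  simp_rw [e]
  apply Finset.sum_pos'
  · intro i _
    exact hG.posSemidef.dotProduct_mulVec_nonneg _
  · by_contra hcon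
    push Not at hcon
    apply hA0
    apply Finset.sum_eq_zero
    intro i hi
    have : v i = 0 := by
      by_contra hv
      exact absurd (hG.dotProduct_mulVec_pos hv) (not_lt.2 (hcon i hi))
    rw [this]; simp

theorem quad_lt {A G : Matrix (Fin n) (Fin n) ℝ} (hA : A.IsSymm) (hA0 : A ≠ 0)
    (hG : G.PosDef) : ∃ x : Fin n → ℝ, x ⬝ᵥ A.mulVec x < (A * G).trace := by
  by_contra hcon
  push Not at hcon
  have hps : A.PosSemidef := by
    refine Matrix.PosSemidef.of_dotProduct_mulVec_nonneg ?_ fun x => ?_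
    · rw [Matrix.IsHermitian, Matrix.conjTranspose_eq_transpose_of_trivial]; exact hA
    by_contra hneg
    push Not at hneg
    simp only [star_trivial] at hneg
    set q := x ⬝ᵥ A.mulVec x
    have h0 := hcon 0
    simp only [zero_dotProduct] at h0
    set t := (A * G).trace
    have hs : ∀ s : ℝ, t ≤ s * s * q := by
      intro s
      have := hcon (s • x)
      simp only [Matrix.mulVec_smul, dotProduct_smul, smul_dotProduct, smul_eq_mul] at this
      linarith
    have h1 := hs (1 + t / q)
    have hr : 0 ≤ t / q := div_nonneg_of_nonpos h0 hneg.le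
    have hq : t / q * q = t := div_mul_cancel₀ _ hneg.ne
    nlinarith [mul_nonneg hr hr, mul_nonneg hr (neg_nonneg.2 hneg.le)]
  have := hcon 0
  simp only [zero_dotProduct] at this
  linarith [trace_pos_aux hps hA0 hG]

theorem continuous_quad (A : Matrix (Fin n) (Fin n) ℝ) :
    Continuous fun x : Fin n → ℝ => x ⬝ᵥ A.mulVec x := by
  fun_prop

theorem mem_Dom {G : Matrix (Fin n) (Fin n) ℝ} (hG : G.PosDef) :
    gq n G ∈ EFam.Dom (volume : Measure (Fin n → ℝ)) Tq := by
  intro A hA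
  obtain ⟨x, hx⟩ := quad_lt (A := A.val) A.prop (fun h => hA (SymT.ext' h)) hG
  refine IsOpen.measure_pos _ ?_ ⟨x, ?_⟩
  · simp only [Tq_apply]
    exact isOpen_lt continuous_const (continuous_const.mul (continuous_quad _))
  · change gq n G A < Tq x A
    rw [gq_apply, Tq_apply]
    linarith

theorem Tq_norm (x : Fin n → ℝ) : ‖Tq x‖ ≤ (n : ℝ) ^ 2 * ‖x‖ ^ 2 := by
  refine ContinuousLinearMap.opNorm_le_bound _ (by positivity) fun A => ?_
  rw [Tq_apply]
  have h1 : |x ⬝ᵥ A.val.mulVec x| ≤ (n : ℝ) ^ 2 * ‖x‖ ^ 2 * ‖A‖ := by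
    simp only [dotProduct, Matrix.mulVec]
    calc |∑ i, x i * ∑ j, A.val i j * x j|
        ≤ ∑ i : Fin n, ∑ j : Fin n, ‖x‖ * (‖A‖ * ‖x‖) := by
          refine (Finset.abs_sum_le_sum_abs _ _).trans (Finset.sum_le_sum fun i _ => ?_)
          rw [Finset.mul_sum]
          refine (Finset.abs_sum_le_sum_abs _ _).trans (Finset.sum_le_sum fun j _ => ?_)
          rw [abs_mul, abs_mul]
          have hx : ∀ i, |x i| ≤ ‖x‖ := fun i => norm_le_pi_norm x i
          have hA : |A.val i j| ≤ ‖A‖ :=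
            A.norm_entry i j
          gcongr
          · exact hx i
          · exact hx j
      _ = _ := by simp; ring
  rw [Real.norm_eq_abs, abs_mul]
  have h2 : |(-(1/2) : ℝ)| = 1 / 2 := by norm_num
  rw [h2]
  nlinarith [abs_nonneg (x ⬝ᵥ A.val.mulVec x)]

theorem Tq_cont : Continuous (Tq : (Fin n → ℝ) → StrongDual ℝ (SymT n)) := by
  rw [continuous_clm_apply]
  intro A
  simp only [Tq_apply]
  exact continuous_const.mul (continuous_quad _)

theorem SuperQuadratic.bdd {U : (Fin n → ℝ) → ℝ} (hU : SuperQuadratic U) (c : ℝ) (hc : 0 < c) :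
    ∃ K, 0 ≤ K ∧ ∀ x, c * ‖x‖ ^ 2 - K ≤ U x := by
  have hcont : Continuous (fun x : Fin n → ℝ => U x - c * ‖x‖ ^ 2) :=
    hU.1.sub (by fun_prop)
  obtain ⟨a, ha⟩ := hcont.exists_forall_le (hU.2 c hc)
  refine ⟨|U a - c * ‖a‖ ^ 2|, abs_nonneg _, fun x => ?_⟩
  have := ha x
  have := neg_abs_le (U a - c * ‖a‖ ^ 2)
  linarith

theorem integrable_gauss : Integrable (fun x : Fin n → ℝ => Real.exp (-(((n : ℝ) + 1) * ‖x‖ ^ 2))) := by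
  have h1 : Integrable (fun x : Fin n → ℝ => ∏ i, Real.exp (-1 * x i ^ 2)) :=
    Integrable.fintype_prod (f := fun _ y => Real.exp (-1 * y ^ 2))
      (fun _ => integrable_exp_neg_mul_sq one_pos)
  refine h1.mono' (Continuous.aestronglyMeasurable (by fun_prop)) (ae_of_all _ fun x => ?_)
  rw [Real.norm_eq_abs, abs_of_pos (Real.exp_pos _), ← Real.exp_sum, Real.exp_le_exp]
  have : ∑ i, x i ^ 2 ≤ ∑ i : Fin n, ‖x‖ ^ 2 := by
    refine Finset.sum_le_sum fun i _ => ?_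
    rw [← sq_abs]
    have hx : |x i| ≤ ‖x‖ := norm_le_pi_norm x i
    gcongr
  simp only [Finset.sum_const, Finset.card_univ, Fintype.card_fin, nsmul_eq_mul] at this
  rw [← Finset.mul_sum]
  nlinarith [sq_nonneg ‖x‖]

theorem SuperQuadratic.int {U : (Fin n → ℝ) → ℝ} (hU : SuperQuadratic U) (c : ℝ) :
    Integrable (fun x : Fin n → ℝ => Real.exp (c * ‖x‖ ^ 2 - U x)) := by
  obtain ⟨K, _, hK⟩ := hU.bdd (|c| + (n + 1)) (by positivity)
  have hUc := hU.1
  refine (integrable_gauss.const_mul (Real.exp K)).mono'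
    (Continuous.aestronglyMeasurable (by fun_prop)) (ae_of_all _ fun x => ?_)
  rw [Real.norm_eq_abs, abs_of_pos (Real.exp_pos _), ← Real.exp_add, Real.exp_le_exp]
  have := hK x
  nlinarith [mul_le_mul_of_nonneg_right (le_abs_self c) (sq_nonneg ‖x‖)]

theorem SuperQuadratic.half {U : (Fin n → ℝ) → ℝ} (hU : SuperQuadratic U) :
    SuperQuadratic (fun x => U x / 2) := by
  refine ⟨hU.1.div_const 2, fun c hc => ?_⟩
  have := (hU.2 (2 * c) (by linarith)).atTop_div_const (r := 2) two_pos
  refine this.congr fun x => ?_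
  ring

theorem SuperQuadratic.hyp {U : (Fin n → ℝ) → ℝ} (hU : SuperQuadratic U) :
    EFam.Hyp (volume : Measure (Fin n → ℝ)) Tq U := by
  have hUc := hU.1
  have hTc := Tq_cont (n := n)
  refine ⟨hTc.aestronglyMeasurable, hUc.aestronglyMeasurable, fun c => ?_⟩
  refine (hU.int (|c| * n ^ 2)).mono'
    (Continuous.aestronglyMeasurable (by fun_prop)) (ae_of_all _ fun x => ?_)
  rw [Real.norm_eq_abs, abs_of_pos (Real.exp_pos _), Real.exp_le_exp]
  have h1 : c * ‖Tq x‖ ≤ |c| * ‖Tq x‖ := by gcongr; exact le_abs_self c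
  have h2 : |c| * ‖Tq x‖ ≤ |c| * (n ^ 2 * ‖x‖ ^ 2) := by gcongr; exact Tq_norm x
  linarith

theorem SuperQuadratic.intU {U : (Fin n → ℝ) → ℝ} (hU : SuperQuadratic U) (a : SymT n) :
    Integrable (fun x : Fin n → ℝ => U x * Real.exp (Tq x a - U x)) := by
  have hUc := hU.1
  have hTc := Tq_cont (n := n)
  obtain ⟨K, hK0, hK⟩ := hU.half.bdd 1 one_pos
  refine ((hU.half.hyp.int1 a).const_mul (2 * Real.exp (2 * K))).mono'
    (Continuous.aestronglyMeasurable (by fun_prop)) (ae_of_all _ fun x => ?_)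
  rw [norm_mul, Real.norm_eq_abs, Real.norm_eq_abs, abs_of_pos (Real.exp_pos _)]
  have h1 : |U x| ≤ 2 * Real.exp (U x / 2 + 2 * K) := by
    have h2 := Real.add_one_le_exp (U x / 2 + 2 * K)
    have h3 := hK x
    rw [abs_le]
    constructor <;> nlinarith [sq_nonneg ‖x‖]
  calc |U x| * Real.exp (Tq x a - U x)
      ≤ 2 * Real.exp (U x / 2 + 2 * K) * Real.exp (Tq x a - U x) := by gcongr
    _ = 2 * Real.exp (2 * K) * Real.exp (Tq x a - U x / 2) := by
      rw [mul_assoc, mul_assoc, ← Real.exp_add, ← Real.exp_add]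
      congr 2; ring

theorem Tq_sum (x : Fin n → ℝ) (a : SymT n) (r : ℝ) : Tq x a * r =
    ∑ i, ∑ j, (-(1 / 2) * a.val i j) * (x j * x i * r) := by
  rw [Tq_apply]
  simp only [dotProduct, Matrix.mulVec, Finset.mul_sum, Finset.sum_mul]
  refine Finset.sum_congr rfl fun i _ => Finset.sum_congr rfl fun j _ => ?_
  ring

theorem mom_int {ρ : (Fin n → ℝ) → ℝ} (h : ∀ i j : Fin n, Integrable fun x => x i * x j * ρ x)
    (a : SymT n) : Integrable (fun x => Tq x a * ρ x) := by
  simp only [Tq_sum]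
  exact integrable_finsetSum _ fun i _ => integrable_finsetSum _ fun j _ => (h j i).const_mul _

theorem mom_eq {ρ : (Fin n → ℝ) → ℝ} (h : ∀ i j : Fin n, Integrable fun x => x i * x j * ρ x)
    (a : SymT n) : ∫ x, Tq x a * ρ x = gq n (momMatrix ρ) a := by
  simp only [Tq_sum]
  rw [integral_finsetSum _ fun i _ => integrable_finsetSum _ fun j _ => (h j i).const_mul _]
  rw [gq_apply, Matrix.trace, Finset.mul_sum]
  refine Finset.sum_congr rfl fun i _ => ?_
  rw [integral_finsetSum _ fun j _ => (h j i).const_mul _]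
  rw [Matrix.diag_apply, Matrix.mul_apply, Finset.mul_sum]
  refine Finset.sum_congr rfl fun j _ => ?_
  rw [integral_const_mul, momMatrix, Matrix.of_apply, mul_assoc]

theorem mom_symm (ρ : (Fin n → ℝ) → ℝ) : (momMatrix ρ).IsSymm := by
  ext i j
  simp only [Matrix.transpose_apply, momMatrix, Matrix.of_apply]
  congr 1; ext x; ring

abbrev ZZ (U : (Fin n → ℝ) → ℝ) (a : SymT n) : ℝ := EFam.Z volume Tq U a

theorem gibbs {U : (Fin n → ℝ) → ℝ} (hU : SuperQuadratic U) {ρ : (Fin n → ℝ) → ℝ}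
    (hρ : IsGoodDensity ρ) (hUρ : Integrable fun x => U x * ρ x) (a : SymT n) :
    entropy ρ - ∫ x, U x * ρ x ≤ Real.log (ZZ U a) - gq n (momMatrix ρ) a := by
  obtain ⟨hm, h0, h1, hmom, hent⟩ := hρ
  have hZ : 0 < ZZ U a := hU.hyp.Z_pos a
  have hi : Integrable ρ := by
    by_contra hcon
    rw [integral_undef hcon] at h1
    exact zero_ne_one h1
  have hp : Integrable (fun x => (ZZ U a)⁻¹ * Real.exp (Tq x a - U x)) :=
    (hU.hyp.int1 a).const_mul _
  have i1 : Integrable (fun x => Tq x a * ρ x - U x * ρ x) := (mom_int hmom a).sub hUρ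
  have i2 : Integrable (fun x => Tq x a * ρ x - U x * ρ x - Real.log (ZZ U a) * ρ x) :=
    i1.sub (hi.const_mul _)
  have key : ∫ x, (Tq x a * ρ x - U x * ρ x - Real.log (ZZ U a) * ρ x - ρ x * Real.log (ρ x)) ≤
      ∫ x, ((ZZ U a)⁻¹ * Real.exp (Tq x a - U x) - ρ x) := by
    refine integral_mono (i2.sub hent) (hp.sub hi) fun x => ?_
    simp only
    rcases (h0 x).eq_or_lt with h | h
    · rw [← h]
      simp only [mul_zero, zero_mul, sub_zero]
      positivity
    · have hl := Real.log_le_sub_one_of_pos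
        (x := (ZZ U a)⁻¹ * Real.exp (Tq x a - U x) / ρ x) (by positivity)
      rw [Real.log_div (by positivity) h.ne', Real.log_mul (by positivity) (by positivity),
        Real.log_inv, Real.log_exp] at hl
      have := mul_le_mul_of_nonneg_left hl h.le
      rw [mul_sub, mul_sub, mul_div_cancel₀ _ h.ne'] at this
      linarith
  rw [integral_sub i2 hent, integral_sub i1 (hi.const_mul _), integral_sub (mom_int hmom a) hUρ,
    integral_const_mul, integral_sub hp hi, integral_const_mul, ← EFam.Z_eq, h1, mom_eq hmom,
    inv_mul_cancel₀ hZ.ne'] at key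
  rw [entropy]
  linarith

theorem attain {U : (Fin n → ℝ) → ℝ} (hU : SuperQuadratic U) {G : Matrix (Fin n) (Fin n) ℝ}
    (hG : G.IsSymm) {a : SymT n} (ha : EFam.M volume Tq U a = gq n G) :
    ∃ ρ : (Fin n → ℝ) → ℝ, IsGoodDensity ρ ∧
    (Integrable fun x => U x * ρ x) ∧ momMatrix ρ = G ∧
    Real.log (ZZ U a) - gq n G a = entropy ρ - ∫ x, U x * ρ x := by
  have hUc := hU.1
  have hTc := Tq_cont (n := n)
  have hZ : 0 < ZZ U a := hU.hyp.Z_pos a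
  set ρ : (Fin n → ℝ) → ℝ := fun x => (ZZ U a)⁻¹ * Real.exp (Tq x a - U x) with hρ
  have hρc : Continuous ρ := by fun_prop
  have hi : Integrable ρ := (hU.hyp.int1 a).const_mul _
  have h1 : ∫ x, ρ x = 1 := by
    rw [integral_const_mul, ← EFam.Z_eq, inv_mul_cancel₀ hZ.ne']
  have hUρ : Integrable fun x => U x * ρ x := by
    refine ((hU.intU a).const_mul (ZZ U a)⁻¹).congr (ae_of_all _ fun x => ?_)
    simp only [hρ]; ring
  have hmom : ∀ i j : Fin n, Integrable fun x => x i * x j * ρ x := by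
    intro i j
    obtain ⟨K, hK0, hK⟩ := hU.half.bdd 1 one_pos
    have hg : Integrable (fun x : Fin n → ℝ => Real.exp (((n:ℝ) ^ 2 * ‖a‖ + 1) * ‖x‖ ^ 2 - U x)) :=
      hU.int _
    refine (hg.const_mul (ZZ U a)⁻¹).mono'
      (Continuous.aestronglyMeasurable (by fun_prop)) (ae_of_all _ fun x => ?_)
    have hx : ∀ i, |x i| ≤ ‖x‖ := fun i => norm_le_pi_norm x i
    have e1 : |x i| * |x j| ≤ Real.exp (‖x‖ ^ 2) := by
      have : |x i| * |x j| ≤ ‖x‖ * ‖x‖ := by gcongr <;> apply hx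
      nlinarith [Real.add_one_le_exp (‖x‖ ^ 2)]
    have e2 : Real.exp (Tq x a - U x) ≤ Real.exp ((n:ℝ) ^ 2 * ‖a‖ * ‖x‖ ^ 2 - U x) := by
      rw [Real.exp_le_exp]
      have h1 : Tq x a ≤ ‖Tq x‖ * ‖a‖ := (le_abs_self _).trans ((Tq x).le_opNorm a)
      have h2 : ‖Tq x‖ * ‖a‖ ≤ (n:ℝ) ^ 2 * ‖x‖ ^ 2 * ‖a‖ := by gcongr; exact Tq_norm x
      linarith
    rw [norm_mul, norm_mul, Real.norm_eq_abs, Real.norm_eq_abs, Real.norm_eq_abs]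
    have e3 : |ρ x| = (ZZ U a)⁻¹ * Real.exp (Tq x a - U x) := abs_of_pos (by positivity)
    have e4 : Real.exp (((n:ℝ) ^ 2 * ‖a‖ + 1) * ‖x‖ ^ 2 - U x) =
        Real.exp (‖x‖ ^ 2) * Real.exp ((n:ℝ) ^ 2 * ‖a‖ * ‖x‖ ^ 2 - U x) := by
      rw [← Real.exp_add]; congr 1; ring
    rw [e3, e4]
    calc _ = (ZZ U a)⁻¹ * (|x i| * |x j| * Real.exp (Tq x a - U x)) := by ring
      _ ≤ _ := by gcongr
  have hlog : ∀ x, ρ x * Real.log (ρ x) =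
      Tq x a * ρ x - U x * ρ x - Real.log (ZZ U a) * ρ x := by
    intro x
    have : Real.log (ρ x) = - Real.log (ZZ U a) + (Tq x a - U x) := by
      rw [hρ]
      simp only
      rw [Real.log_mul (by positivity) (by positivity), Real.log_inv, Real.log_exp]
    rw [this]; ring
  have i1 : Integrable (fun x => Tq x a * ρ x - U x * ρ x) := (mom_int hmom a).sub hUρ
  have hent : Integrable fun x => ρ x * Real.log (ρ x) := by
    simp only [hlog]
    exact i1.sub (hi.const_mul _)
  have hMG : momMatrix ρ = G := by
    refine gq_inj (mom_symm ρ) hG ?_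
    rw [← ha]
    ext B
    rw [← mom_eq hmom, EFam.M, _root_.smul_apply, hU.hyp.N_apply, smul_eq_mul, ← integral_const_mul]
    congr 1; ext x
    simp only [hρ]; ring
  refine ⟨ρ, ⟨hρc.measurable, fun x => by positivity, h1, hmom, hent⟩, hUρ, hMG, ?_⟩
  rw [entropy]
  simp only [hlog]
  rw [integral_sub i1 (hi.const_mul _), integral_sub (mom_int hmom a) hUρ, integral_const_mul, h1,
    mom_eq hmom, hMG]
  ring

theorem posDef_symm {G : Matrix (Fin n) (Fin n) ℝ} (hG : G.PosDef) : G.IsSymm := by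
  have := hG.isHermitian
  rwa [Matrix.IsHermitian, Matrix.conjTranspose_eq_transpose_of_trivial] at this

theorem Ffun_eq {U : (Fin n → ℝ) → ℝ} (hU : SuperQuadratic U) {G : Matrix (Fin n) (Fin n) ℝ}
    (hG : G.IsSymm) {a : SymT n} (ha : EFam.M volume Tq U a = gq n G) :
    Ffun n U G = Real.log (ZZ U a) - gq n G a := by
  refine IsGreatest.csSup_eq ⟨attain hU hG ha, ?_⟩
  rintro r ⟨ρ, hρ, hUρ, rfl, rfl⟩
  exact gibbs hU hρ hUρ a

theorem Omega_eq {U : (Fin n → ℝ) → ℝ} (a : SymT n) :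
    Omega n U a.val = - Real.log (ZZ U a) := by
  rw [Omega, Zfun, ZZ, EFam.Z_eq]
  rfl

theorem Ffun_le {U : (Fin n → ℝ) → ℝ} (hU : SuperQuadratic U) {G : Matrix (Fin n) (Fin n) ℝ}
    (hG : G.PosDef) (b : SymT n) (hb : EFam.M volume Tq U b ≠ gq n G) :
    Ffun n U G < Real.log (ZZ U b) - gq n G b := by
  obtain ⟨a, ha⟩ := hU.hyp.exists_crit (mem_Dom hG)
  rw [Ffun_eq hU (posDef_symm hG) ha]
  refine hU.hyp.strict_min (mem_Dom hG) ?_ ha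
  rintro rfl
  exact hb ha

end Concrete

/-- `𝓕` is strictly concave and infinitely differentiable on the open cone
of symmetric positive definite matrices, and `𝓕` is the concave Legendre conjugate of
`Ω`: for every symmetric positive definite `G`,
`𝓕[G] = inf over symmetric A of (½ Tr[AG] - Ω[A])`. -/
theorem statement5 (n : ℕ) (hn : 1 ≤ n) (U : (Fin n → ℝ) → ℝ) (hU : SuperQuadratic U) :
    StrictConcaveOn ℝ {G : Matrix (Fin n) (Fin n) ℝ | G.PosDef} (Ffun n U) ∧
    ContDiffOn ℝ (⊤ : ℕ∞) (Ffun n U) {G : Matrix (Fin n) (Fin n) ℝ | G.PosDef} ∧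
    ∀ G : Matrix (Fin n) (Fin n) ℝ, G.PosDef →
      Ffun n U G = sInf { r : ℝ | ∃ A : Matrix (Fin n) (Fin n) ℝ, A.IsSymm ∧
        r = (1 / 2) * (A * G).trace - Omega n U A } := by
  refine ⟨⟨?_, ?_⟩, ?_, ?_⟩
  · intro G hG H hH s t hs ht hst
    rcases hs.eq_or_lt with rfl | hs
    · rw [zero_add] at hst; subst hst; simpa using hH
    rcases ht.eq_or_lt with rfl | ht
    · rw [add_zero] at hst; subst hst; simpa using hG
    exact (Matrix.PosDef.smul hG hs).add (Matrix.PosDef.smul hH ht)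
  · intro G hG H hH hne s t hs ht hst
    have hK : (s • G + t • H).PosDef := (Matrix.PosDef.smul hG hs).add (Matrix.PosDef.smul hH ht)
    obtain ⟨a, ha⟩ := hU.hyp.exists_crit (mem_Dom hK)
    rw [Ffun_eq hU (posDef_symm hK) ha]
    have hle : ∀ {K : Matrix (Fin n) (Fin n) ℝ}, K.PosDef →
        Ffun n U K ≤ Real.log (ZZ U a) - gq n K a := by
      intro K hK
      by_cases h : EFam.M volume Tq U a = gq n K
      · exact (Ffun_eq hU (posDef_symm hK) h).le
      · exact (Ffun_le hU hK a h).le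
    have e : Real.log (ZZ U a) - gq n (s • G + t • H) a =
        s * (Real.log (ZZ U a) - gq n G a) + t * (Real.log (ZZ U a) - gq n H a) := by
      rw [map_add, map_smul, map_smul]
      simp only [_root_.add_apply, _root_.smul_apply, smul_eq_mul]
      linear_combination (-Real.log (ZZ U a)) * hst
    rw [e, smul_eq_mul, smul_eq_mul]
    by_cases h : EFam.M volume Tq U a = gq n G
    · have h' : EFam.M volume Tq U a ≠ gq n H := fun h2 =>
        hne (gq_inj (posDef_symm hG) (posDef_symm hH) (h.symm.trans h2))
      have l1 := mul_le_mul_of_nonneg_left (hle hG) hs.le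
      have l2 := mul_lt_mul_of_pos_left (Ffun_le hU hH a h') ht
      linarith
    · have l1 := mul_lt_mul_of_pos_left (Ffun_le hU hG a h) hs
      have l2 := mul_le_mul_of_nonneg_left (hle hH) ht.le
      linarith
  · classical
    let f : StrongDual ℝ (SymT n) → ℝ := fun g =>
      if h : ∃ a, EFam.M volume Tq U a = g then
        Real.log (ZZ U h.choose) - g h.choose else 0
    have hf : ContDiffOn ℝ (⊤ : ℕ∞) f (EFam.Dom volume Tq) := by
      refine hU.hyp.smooth f fun g hg a ha => ?_
      have hex : ∃ a, EFam.M volume Tq U a = g := ⟨a, ha⟩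
      have : hex.choose = a := hU.hyp.inj hg hex.choose_spec ha
      simp only [f, dif_pos hex, this, ZZ]
    have hcomp : ContDiffOn ℝ (⊤ : ℕ∞) (fun G => f (gq n G))
        {G : Matrix (Fin n) (Fin n) ℝ | G.PosDef} :=
      hf.comp (gq n).contDiff.contDiffOn fun G hG => mem_Dom hG
    refine hcomp.congr fun G hG => ?_
    have hex : ∃ a, EFam.M volume Tq U a = gq n G := hU.hyp.exists_crit (mem_Dom hG)
    simp only [f, dif_pos hex]
    exact Ffun_eq hU (posDef_symm hG) hex.choose_spec
  · intro G hG
    symm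
    have hr : ∀ a : SymT n, (1 / 2) * (a.val * G).trace - Omega n U a.val =
        Real.log (ZZ U a) - gq n G a := by
      intro a
      rw [Omega_eq, gq_apply]; ring
    refine IsLeast.csInf_eq ⟨?_, ?_⟩
    · obtain ⟨a, ha⟩ := hU.hyp.exists_crit (mem_Dom hG)
      exact ⟨a.val, a.prop, by rw [hr, Ffun_eq hU (posDef_symm hG) ha]⟩
    · rintro r ⟨A, hA, rfl⟩
      have h1 := hr (SymT.mk A hA)
      rw [SymT.mk_val] at h1
      rw [h1]
      by_cases h : EFam.M volume Tq U (SymT.mk A hA) = gq n G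
      · exact (Ffun_eq hU (posDef_symm hG) h).le
      · exact (Ffun_le hU hG _ h).le
end
end

section
/- The functional 𝓕 diverges to -∞ at the boundary of the positive definite cone: if (G_k) is a sequence of symmetric positive definite n×n matrices converging to a symmetric positive semidefinite matrix G that is singular (has nontrivial kernel), then 𝓕[G_k] → -∞. -/
open MeasureTheory Matrix Filter Topology Real Asymptotics

attribute [local instance] Matrix.normedAddCommGroup Matrix.normedSpace

noncomputable section

lemma one_d (p : ℝ → ℝ) (hp : p = (Set.Icc (-√3) (√3)).indicator (fun _ => 1/(2*√3))) (k : ℕ) :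
   ∫ x, x^k * p x = 1/(2*√3) * ((√3)^(k+1) - (-√3)^(k+1))/(k+1) := by
  have h3 : (0:ℝ) < √3 := by positivity
  have : (fun x => x^k * p x) = (Set.Icc (-√3) (√3)).indicator (fun x => x^k * (1/(2*√3))) := by
    ext x; subst hp; by_cases hx : x ∈ Set.Icc (-√3) (√3) <;> simp [Set.indicator, hx]
  rw [this, integral_indicator measurableSet_Icc, integral_Icc_eq_integral_Ioc,
    ← intervalIntegral.integral_of_le (by linarith), intervalIntegral.integral_mul_const, integral_pow]
  ring

lemma upper_int (n : ℕ) (v : Fin n → ℝ) (hv : v ≠ 0) :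
    (∀ t : ℝ, 0 ≤ t → Integrable (fun x : Fin n → ℝ => Real.exp (-(∑ i, x i ^ 2) - t * (v ⬝ᵥ x)^2))) ∧
    Tendsto (fun t : ℝ => ∫ x : Fin n → ℝ, Real.exp (-(∑ i, x i ^ 2) - t * (v ⬝ᵥ x)^2)) atTop (𝓝 0) := by
  have hI : Integrable (fun x : Fin n → ℝ => Real.exp (-(∑ i, x i ^ 2))) := by
    have := Integrable.fintype_prod (ι := Fin n) (μ := fun _ => (volume : Measure ℝ)) (f := fun _ (x:ℝ) => Real.exp (-1 * x^2))
      (fun _ => integrable_exp_neg_mul_sq one_pos)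
    have h2 : (fun x : Fin n → ℝ => Real.exp (-(∑ i, x i ^ 2))) = fun x => ∏ i, Real.exp (-1 * x i ^ 2) := by
      ext x
      rw [← Real.exp_sum]; simp
    rw [h2]; exact this
  have hm : ∀ t : ℝ, AEStronglyMeasurable (fun x : Fin n → ℝ => Real.exp (-(∑ i, x i ^ 2) - t * (v ⬝ᵥ x)^2)) volume := by
    intro t
    apply Continuous.aestronglyMeasurable
    unfold dotProduct
    fun_prop
  have hb : ∀ t : ℝ, 0 ≤ t → ∀ x : Fin n → ℝ, ‖Real.exp (-(∑ i, x i ^ 2) - t * (v ⬝ᵥ x)^2)‖ ≤ Real.exp (-(∑ i, x i ^ 2)) := by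
    intro t ht x
    rw [Real.norm_eq_abs, Real.abs_exp]
    apply Real.exp_le_exp.2
    have : 0 ≤ t * (v ⬝ᵥ x)^2 := by positivity
    linarith
  refine ⟨fun t ht => hI.mono' (hm t) (ae_of_all _ (hb t ht)), ?_⟩
  rw [← integral_zero (Fin n → ℝ) ℝ (μ := volume)]
  apply tendsto_integral_filter_of_dominated_convergence _ (Eventually.of_forall hm) _ hI
  · have h0 : ∀ᵐ x : Fin n → ℝ, v ⬝ᵥ x ≠ 0 := by
      let f : (Fin n → ℝ) →ₗ[ℝ] ℝ := dotProductBilin ℝ ℝ v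
      have := Measure.addHaar_submodule (volume : Measure (Fin n → ℝ)) (LinearMap.ker f) (by
        intro h
        have : v ∈ LinearMap.ker f := by rw [h]; trivial
        have h2 : v ⬝ᵥ v = 0 := this
        exact hv (dotProduct_self_eq_zero.1 h2))
      rw [ae_iff]
      convert this using 2
      ext x
      simp [f, dotProductBilin]
    filter_upwards [h0] with x hx
    apply Real.tendsto_exp_atBot.comp
    apply tendsto_atBot_add_const_left
    apply tendsto_neg_atTop_atBot.comp
    exact tendsto_id.atTop_mul_const (by positivity)
  · filter_upwards [eventually_ge_atTop 0] with t ht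
    exact ae_of_all _ (hb t ht)

lemma ent_bound (n : ℕ) (ρ : (Fin n → ℝ) → ℝ) (hρ : IsGoodDensity ρ) (v : Fin n → ℝ) (t : ℝ)
    (hI : Integrable (fun x : Fin n → ℝ => Real.exp (-(∑ i, x i ^ 2) - t * (v ⬝ᵥ x)^2))) :
    entropy ρ ≤ (∑ i, momMatrix ρ i i) + t * (v ⬝ᵥ (momMatrix ρ).mulVec v)
      + Real.log (∫ x : Fin n → ℝ, Real.exp (-(∑ i, x i ^ 2) - t * (v ⬝ᵥ x)^2)) := by
  obtain ⟨hm, h0, h1, h2, h3⟩ := hρ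
  set Z := ∫ x : Fin n → ℝ, Real.exp (-(∑ i, x i ^ 2) - t * (v ⬝ᵥ x)^2) with hZ
  have hZpos : 0 < Z := integral_exp_pos hI
  have hIρ : Integrable ρ := Integrable.of_integral_ne_zero (by rw [h1]; norm_num)
  have hA : Integrable (fun x : Fin n → ℝ => ∑ i, x i * x i * ρ x) :=
    integrable_finsetSum _ fun i _ => h2 i i
  have hB : Integrable (fun x : Fin n → ℝ => ∑ i, ∑ j, v i * v j * (x i * x j * ρ x)) :=
    integrable_finsetSum _ fun i _ => integrable_finsetSum _ fun j _ => (h2 i j).const_mul _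
  have hAi : ∫ x : Fin n → ℝ, ∑ i, x i * x i * ρ x = ∑ i, momMatrix ρ i i := by
    rw [integral_finsetSum _ fun i _ => h2 i i]; rfl
  have hBi : ∫ x : Fin n → ℝ, ∑ i, ∑ j, v i * v j * (x i * x j * ρ x) = v ⬝ᵥ (momMatrix ρ).mulVec v := by
    rw [integral_finsetSum _ fun i _ => integrable_finsetSum _ fun j _ => (h2 i j).const_mul _]
    simp only [dotProduct, mulVec]
    refine Finset.sum_congr rfl fun i _ => ?_
    rw [integral_finsetSum _ fun j _ => (h2 i j).const_mul _, Finset.mul_sum]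
    refine Finset.sum_congr rfl fun j _ => ?_
    rw [integral_const_mul]
    simp only [momMatrix, Matrix.of_apply]
    ring
  have key : ∀ x, -(ρ x * Real.log (ρ x)) ≤ (∑ i, x i * x i * ρ x)
      + t * (∑ i, ∑ j, v i * v j * (x i * x j * ρ x)) + Real.log Z * ρ x
      + Real.exp (-(∑ i, x i ^ 2) - t * (v ⬝ᵥ x)^2) * Z⁻¹ - ρ x := by
    intro x
    have e1 : (∑ i, x i * x i * ρ x) = (∑ i, x i ^ 2) * ρ x := by
      rw [Finset.sum_mul]; exact Finset.sum_congr rfl fun i _ => by ring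
    have e2 : (∑ i, ∑ j, v i * v j * (x i * x j * ρ x)) = (v ⬝ᵥ x)^2 * ρ x := by
      rw [sq, dotProduct, Finset.sum_mul_sum, Finset.sum_mul]
      refine Finset.sum_congr rfl fun i _ => ?_
      rw [Finset.sum_mul]
      exact Finset.sum_congr rfl fun j _ => by ring
    rw [e1, e2]
    set a := ∑ i, x i ^ 2
    set b := (v ⬝ᵥ x)^2
    rcases (h0 x).eq_or_lt with h | h
    · rw [← h]; simp; positivity
    · have hq : 0 < Real.exp (-a - t*b) * Z⁻¹ := by positivity
      have := Real.log_le_sub_one_of_pos (div_pos hq h)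
      rw [Real.log_div hq.ne' h.ne', Real.log_mul (Real.exp_pos _).ne' (inv_pos.2 hZpos).ne', Real.log_exp,
        Real.log_inv] at this
      have h5 := mul_le_mul_of_nonneg_left this h.le
      have h6 : ρ x * (Real.exp (-a - t*b) * Z⁻¹ / ρ x - 1) = Real.exp (-a - t*b) * Z⁻¹ - ρ x := by
        field_simp
      rw [h6] at h5
      linarith
  have hint := integral_mono h3.neg (((((hA.add (hB.const_mul t)).add (hIρ.const_mul (Real.log Z))).add
    (hI.mul_const Z⁻¹)).sub hIρ)) key
  simp only [Pi.neg_apply] at hint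
  rw [integral_neg, integral_sub' ((((hA.add (hB.const_mul t)).add (hIρ.const_mul (Real.log Z))).add
    (hI.mul_const Z⁻¹))) hIρ, integral_add' (((hA.add (hB.const_mul t)).add (hIρ.const_mul (Real.log Z))))
    (hI.mul_const Z⁻¹), integral_add' ((hA.add (hB.const_mul t))) (hIρ.const_mul (Real.log Z)),
    integral_add' hA (hB.const_mul t), integral_const_mul, integral_const_mul, integral_mul_const, hAi, hBi, h1, ← hZ,
    mul_inv_cancel₀ hZpos.ne'] at hint
  unfold entropy
  linarith

lemma exists_dens (n : ℕ) (U : (Fin n → ℝ) → ℝ) (hU : Continuous U) (G : Matrix (Fin n) (Fin n) ℝ)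
    (hG : G.PosDef) : ∃ ρ : (Fin n → ℝ) → ℝ, IsGoodDensity ρ ∧
    (Integrable fun x => U x * ρ x) ∧ momMatrix ρ = G := by
  obtain ⟨B, hB⟩ : ∃ B : Matrix (Fin n) (Fin n) ℝ, G = Bᵀ * B := by
    open scoped MatrixOrder ComplexOrder in
    obtain ⟨B, hB⟩ := CStarAlgebra.nonneg_iff_eq_star_mul_self.mp hG.posSemidef.nonneg
    exact ⟨B, by rw [hB, star_eq_conjTranspose, conjTranspose_eq_transpose_of_trivial]⟩
  set L := Bᵀ with hL
  have hdet : L.det ≠ 0 := by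
    intro h
    have := hG.det_pos
    rw [hB, det_mul, h] at this
    simp at this
  have hu : IsUnit L.det := isUnit_iff_ne_zero.2 hdet
  set M := L⁻¹ with hM
  have hML : M * L = 1 := nonsing_inv_mul _ hu
  have hLM : L * M = 1 := mul_nonsing_inv _ hu
  have hMdet : M.det ≠ 0 := by
    intro h
    have := congrArg det hML
    rw [det_mul, h] at this
    simp at this
  have h3 : (0:ℝ) < √3 := by positivity
  set p : ℝ → ℝ := (Set.Icc (-√3) (√3)).indicator (fun _ => 1/(2*√3)) with hp
  have p0 : ∫ x, p x = 1 := by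
    have := one_d p hp 0
    simp at this
    rw [this]; field_simp; norm_num
  have p1 : ∫ x, x * p x = 0 := by
    have := one_d p hp 1
    simp at this
    exact this
  have p2 : ∫ x, x * x * p x = 1 := by
    have := one_d p hp 2
    have h4 : (√3)^2 = 3 := Real.sq_sqrt (by norm_num)
    have e : (√3)^(2+1) = 3 * √3 := by rw [pow_succ, h4]
    have e' : (-√3)^(2+1) = -(3 * √3) := by rw [← e]; ring
    rw [e, e'] at this
    simp only [← sq]
    rw [this]; field_simp; norm_num
  set Q : Set (Fin n → ℝ) := Set.Icc (fun _ => -√3) (fun _ => √3) with hQ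
  set q : (Fin n → ℝ) → ℝ := fun y => ∏ i, p (y i) with hq
  have hqQ : ∀ y, q y = Q.indicator (fun _ => (1/(2*√3))^n) y := by
    intro y
    by_cases hy : y ∈ Q
    · rw [Set.indicator_of_mem hy]
      have : ∀ i, p (y i) = 1/(2*√3) := fun i =>
        Set.indicator_of_mem (show y i ∈ Set.Icc (-√3) (√3) from ⟨hy.1 i, hy.2 i⟩) _
      simp only [hq, this]; simp
    · rw [Set.indicator_of_notMem hy]
      have : ∃ i, y i ∉ Set.Icc (-√3) (√3) := by
        by_contra! hc
        exact hy ⟨fun i => (hc i).1, fun i => (hc i).2⟩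
      obtain ⟨i, hi⟩ := this
      exact Finset.prod_eq_zero (Finset.mem_univ i) (Set.indicator_of_notMem hi _)
  have hqi : ∀ g : (Fin n → ℝ) → ℝ, Continuous g → Integrable fun y => g y * q y := by
    intro g hg
    have : (fun y => g y * q y) = Q.indicator (fun y => g y * (1/(2*√3))^n) := by
      ext y; rw [hqQ]; by_cases hy : y ∈ Q <;> simp [hy]
    rw [this, integrable_indicator_iff measurableSet_Icc]
    exact ContinuousOn.integrableOn_compact isCompact_Icc (by fun_prop)
  have q0 : ∫ y, q y = 1 := by
    rw [hq, integral_fintype_prod_volume_eq_prod (fun _ => p)]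
    simp [p0]
  have q2 : ∀ a b : Fin n, ∫ y, y a * y b * q y = (1 : Matrix (Fin n) (Fin n) ℝ) a b := by
    intro a b
    have : (fun y : Fin n → ℝ => y a * y b * q y) = fun y => ∏ i, ((if i = a then y i else 1) * (if i = b then y i else 1) * p (y i)) := by
      ext y
      rw [Finset.prod_mul_distrib, Finset.prod_mul_distrib]
      simp [hq]
    rw [this, integral_fintype_prod_volume_eq_prod (fun i (s : ℝ) => (if i = a then s else 1) * (if i = b then s else 1) * p s)]
    by_cases hab : a = b
    · subst hab
      rw [one_apply_eq]
      apply Finset.prod_eq_one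
      intro i _
      by_cases hi : i = a <;> simp [hi, p0, p2]
    · rw [one_apply_ne hab]
      apply Finset.prod_eq_zero (Finset.mem_univ a)
      simp [hab, p1]
  -- change of variables
  have hmap := Real.map_matrix_volume_pi_eq_smul_volume_pi hMdet
  have hemb : MeasurableEmbedding (toLin' M) := by
    apply Continuous.measurableEmbedding
    · exact LinearMap.continuous_of_finiteDimensional _
    · intro x y hxy
      have := congrArg (L.mulVec) hxy
      simpa [toLin'_apply, hLM] using this
  have cvI : ∀ h : (Fin n → ℝ) → ℝ, Integrable h → Integrable fun x => h (M.mulVec x) := by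
    intro h hh
    have h2 : Integrable h (Measure.map (toLin' M) volume) := by
      rw [hmap]; exact hh.smul_measure ENNReal.ofReal_ne_top
    exact hemb.integrable_map_iff.1 h2
  have cv : ∀ h : (Fin n → ℝ) → ℝ, ∫ x, h (M.mulVec x) = |M.det|⁻¹ * ∫ y, h y := by
    intro h
    have := hemb.integral_map (μ := volume) h
    rw [hmap, integral_smul_measure, ENNReal.toReal_ofReal (abs_nonneg _), abs_inv] at this
    simpa [toLin'_apply] using this.symm
  have hd : 0 < |M.det| := abs_pos.2 hMdet
  set ρ : (Fin n → ℝ) → ℝ := fun x => |M.det| * q (M.mulVec x) with hρ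
  have hLMx : ∀ x, L.mulVec (M.mulVec x) = x := by intro x; simp [hLM]
  have ρI : ∀ g : (Fin n → ℝ) → ℝ, Continuous g → Integrable fun x => g x * ρ x := by
    intro g hg
    have hc : Continuous fun y => g (L.mulVec y) * |M.det| := by
      refine (hg.comp ?_).mul continuous_const
      exact Continuous.matrix_mulVec continuous_const continuous_id
    have := cvI _ (hqi _ hc)
    simp only [hLMx] at this
    convert this using 2 with x
    simp only [hρ]; ring
  have ρi : ∀ g : (Fin n → ℝ) → ℝ, ∫ x, g x * ρ x = ∫ y, g (L.mulVec y) * q y := by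
    intro g
    have := cv (fun y => |M.det| * (g (L.mulVec y) * q y))
    simp only [hLMx] at this
    rw [integral_const_mul (μ := volume) (|M.det|) (fun y => g (L.mulVec y) * q y),
      inv_mul_cancel_left₀ hd.ne'] at this
    rw [← this]
    congr 1; ext x; simp only [hρ]; ring
  have qm : Measurable q := by
    have : q = Q.indicator (fun _ => (1/(2*√3))^n) := funext hqQ
    rw [this]
    exact measurable_const.indicator measurableSet_Icc
  have q_nn : ∀ y, 0 ≤ q y := by
    intro y; rw [hqQ]; exact Set.indicator_nonneg (fun _ _ => by positivity) _
  refine ⟨ρ, ⟨?_, ?_, ?_, ?_, ?_⟩, ρI U hU, ?_⟩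
  · exact (qm.comp (Continuous.matrix_mulVec continuous_const continuous_id).measurable).const_mul _
  · intro x; exact mul_nonneg hd.le (q_nn _)
  · have := ρi (fun _ => 1)
    simpa [q0] using this
  · intro i j
    exact ρI (fun x => x i * x j) (by fun_prop)
  · have : (fun x => ρ x * Real.log (ρ x)) = fun x => Real.log (|M.det| * (1/(2*√3))^n) * ρ x := by
      ext x
      simp only [hρ, hqQ]
      by_cases hy : M.mulVec x ∈ Q
      · rw [Set.indicator_of_mem hy]; ring
      · rw [Set.indicator_of_notMem hy]; simp
    rw [this]
    exact ρI (fun _ => _) continuous_const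
  · ext i j
    have e : (momMatrix ρ) i j = ∫ x, x i * x j * ρ x := rfl
    rw [e, ρi (fun x => x i * x j)]
    have e2 : (fun y => (L.mulVec y) i * (L.mulVec y) j * q y) = fun y => ∑ a, ∑ b, L i a * L j b * (y a * y b * q y) := by
      ext y
      simp only [mulVec, dotProduct]
      rw [Finset.sum_mul_sum, Finset.sum_mul]
      refine Finset.sum_congr rfl fun a _ => ?_
      rw [Finset.sum_mul]
      exact Finset.sum_congr rfl fun b _ => by ring
    have hii : ∀ a b : Fin n, Integrable fun y => L i a * L j b * (y a * y b * q y) := fun a b =>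
      (hqi (fun y => y a * y b) (by fun_prop)).const_mul _
    rw [e2, integral_finsetSum _ fun a _ => integrable_finsetSum _ fun b _ => hii a b]
    have e3 : ∀ a, ∫ y, ∑ b, L i a * L j b * (y a * y b * q y) = L i a * L j a := by
      intro a
      rw [integral_finsetSum _ fun b _ => hii a b]
      simp only [integral_const_mul, q2, one_apply]
      simp
    simp only [e3]
    rw [hB, mul_apply]
    simp [hL]

/-- `𝓕` diverges to `-∞` at the boundary of the positive definite cone:
if `(G_k)` are symmetric positive definite and `G_k → G` with `G` positive semidefinite
and singular, then `𝓕[G_k] → -∞`. -/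
theorem statement6 (n : ℕ) (hn : 1 ≤ n) (U : (Fin n → ℝ) → ℝ) (hU : SuperQuadratic U)
    (Gs : ℕ → Matrix (Fin n) (Fin n) ℝ) (hGs : ∀ k, (Gs k).PosDef)
    (G : Matrix (Fin n) (Fin n) ℝ) (hG : G.PosSemidef)
    (hker : ∃ v : Fin n → ℝ, v ≠ 0 ∧ G.mulVec v = 0)
    (hlim : Tendsto Gs atTop (𝓝 G)) :
    Tendsto (fun k => Ffun n U (Gs k)) atTop atBot := by
  obtain ⟨hUc, hUg⟩ := hU
  obtain ⟨v, hv, hGv⟩ := hker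
  have hUt : Tendsto U (cocompact _) atTop := by
    refine tendsto_atTop_mono (fun x => ?_) (hUg 1 one_pos)
    nlinarith [sq_nonneg ‖x‖]
  obtain ⟨x0, hx0⟩ := hUc.exists_forall_le hUt
  obtain ⟨hI, hZ⟩ := upper_int n v hv
  set T := ∑ i, G i i with hT
  rw [tendsto_atBot]
  intro b
  have hlog : Tendsto (fun t : ℝ => Real.log (∫ x : Fin n → ℝ, Real.exp (-(∑ i, x i ^ 2) - t * (v ⬝ᵥ x)^2))) atTop atBot := by
    refine Real.tendsto_log_nhdsGT_zero.comp (tendsto_nhdsWithin_iff.2 ⟨hZ, ?_⟩)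
    filter_upwards [eventually_ge_atTop 0] with t ht
    exact integral_exp_pos (hI t ht)
  obtain ⟨t, ht0, ht⟩ := ((eventually_ge_atTop (0:ℝ)).and
    (hlog.eventually_le_atBot (b + U x0 - T - 1))).exists
  have hlim' : Tendsto (fun k => (∑ i, Gs k i i) + t * (v ⬝ᵥ (Gs k).mulVec v)) atTop (𝓝 (T + t * (v ⬝ᵥ G.mulVec v))) := by
    have hc : Continuous fun A : Matrix (Fin n) (Fin n) ℝ => (∑ i, A i i) + t * (v ⬝ᵥ A.mulVec v) := by
      simp only [dotProduct, mulVec]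
      fun_prop
    exact (hc.tendsto G).comp hlim
  rw [hGv, dotProduct_zero, mul_zero, add_zero] at hlim'
  filter_upwards [hlim'.eventually_lt_const (show T < T + 1 by linarith)] with k hk
  obtain ⟨ρ, h1, h2, h3⟩ := exists_dens n U hUc (Gs k) (hGs k)
  refine csSup_le ⟨_, ρ, h1, h2, h3, rfl⟩ ?_
  rintro r ⟨ρ, h1, h2, h3, rfl⟩
  have hb := ent_bound n ρ h1 v t (hI t ht0)
  rw [h3] at hb
  have hIρ : Integrable ρ := Integrable.of_integral_ne_zero (by rw [h1.2.2.1]; norm_num)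
  have hUi : U x0 ≤ ∫ x, U x * ρ x := by
    have := integral_mono (hIρ.const_mul (U x0)) h2
      (fun x => mul_le_mul_of_nonneg_right (hx0 x) (h1.2.1 x))
    rwa [integral_const_mul, h1.2.2.1, mul_one] at this
  linarith
end
end
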